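/- arXiv:2510.18397 — 2 statements merged into one kernel-verified Lean document; each statement's English description precedes it below -/
import Mathlib

section
/- Let q ≥ 5 be an odd prime power. Then SL_2(𝔽_q) contains a picky 2-element if and only if q is a Fermat prime, a Mersenne prime, or q = 9. -/
/-- `q` is a Fermat prime. -/
def IsFermatPrime (q : ℕ) : Prop := q.Prime ∧ ∃ m : ℕ, q = 2 ^ m + 1

/-- `q` is a Mersenne prime. -/
def IsMersennePrime (q : ℕ) : Prop := q.Prime ∧ ∃ m : ℕ, q = 2 ^ m - 1

theorem natAbs_sub_one_of_natAbs_pow_sub_one {x : ℤ} (hx : Odd x) {k m : ℕ} (hk : Odd k)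
    (h : (x ^ k - 1).natAbs = 2 ^ m) : (x - 1).natAbs = (x ^ k - 1).natAbs := by
  have hS : Odd (∑ i ∈ Finset.range k, x ^ i) := by
    rw [← ZMod.intCast_eq_one_iff_odd] at hx ⊢
    simpa [hx] using ZMod.natCast_eq_one_iff_odd.2 hk
  rw [← geom_sum_mul, Int.natAbs_mul] at h ⊢
  obtain ⟨a, -, ha⟩ := (Nat.dvd_prime_pow Nat.prime_two).1 (h ▸ Nat.dvd_mul_right _ _)
  rw [← Int.natAbs_odd, ha] at hS
  have : a = 0 := by
    by_contra h0
    exact (Nat.not_even_iff_odd.2 hS) ((Nat.even_pow).2 ⟨even_two, h0⟩)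
  simp [ha, this]

theorem two_pow_add_two_eq {a b : ℕ} (h : 2 ^ a + 2 = 2 ^ b) : a = 1 := by
  rcases a with _ | _ | a
  · rcases b with _ | b
    · simp at h
    · rw [pow_succ] at h; omega
  · rfl
  · rcases b with _ | _ | b
    · simp [pow_succ] at h
    · simp [pow_succ] at h
    · simp only [pow_succ] at h; omega

theorem prime_or_eq_nine_of_eq_two_pow_add_one {q m : ℕ} (hq : IsPrimePow q)
    (hodd : Odd q) (h : q = 2 ^ m + 1) : q.Prime ∨ q = 9 := by
  obtain ⟨p, k, hp, hk, rfl⟩ := (isPrimePow_nat_iff _).1 hq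
  have hpo : Odd p :=
    Nat.Odd.of_mul_left (by rwa [← Nat.succ_pred_eq_of_pos hk, pow_succ'] at hodd)
  rcases Nat.even_or_odd k with ⟨j, rfl⟩ | hko
  · right
    have hf : (p ^ j - 1) * (p ^ j + 1) = 2 ^ m := by
      rw [mul_comm, ← Nat.sq_sub_sq, one_pow, ← pow_mul, mul_two, h, Nat.add_sub_cancel]
    obtain ⟨a, -, ha⟩ := (Nat.dvd_prime_pow Nat.prime_two).1 (hf ▸ Nat.dvd_mul_right _ _)
    obtain ⟨b, -, hb⟩ := (Nat.dvd_prime_pow Nat.prime_two).1 (hf ▸ Nat.dvd_mul_left _ _)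
    have h1 := Nat.one_le_pow j p hp.pos
    have := two_pow_add_two_eq (a := a) (b := b) (by omega)
    subst this
    have : p ^ j = 3 := by omega
    rw [pow_add, this]
    rfl
  · left
    have h' := natAbs_sub_one_of_natAbs_pow_sub_one (x := p) (by exact_mod_cast hpo) hko (m := m)
      (by rw [← Nat.cast_pow, h]; push_cast; simp)
    have h1 := Nat.one_le_pow k p hp.pos
    have : p ^ k = p := by have := hp.pos; rw [← Nat.cast_pow] at h'; omega
    rwa [this]

theorem prime_of_add_one_eq_two_pow {q m : ℕ} (hq : IsPrimePow q) (hodd : Odd q) (hq1 : 1 < q)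
    (h : q + 1 = 2 ^ m) : q.Prime := by
  obtain ⟨p, k, hp, hk, rfl⟩ := (isPrimePow_nat_iff _).1 hq
  have hpo : Odd p :=
    Nat.Odd.of_mul_left (by rwa [← Nat.succ_pred_eq_of_pos hk, pow_succ'] at hodd)
  rcases Nat.even_or_odd k with ⟨j, rfl⟩ | hko
  · exfalso
    obtain ⟨c, hc⟩ := hpo.pow (n := j)
    rw [pow_add, hc] at h hq1
    rcases m with _ | _ | m
    · simp at h
    · rw [zero_add, pow_one] at h; omega
    · rw [pow_add] at h
      ring_nf at h
      omega
  · have h' := natAbs_sub_one_of_natAbs_pow_sub_one (x := -p) (by simpa using hpo) hko (m := m)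
      (by rw [hko.neg_pow, ← h, ← Nat.cast_pow]; omega)
    have : p ^ k = p := by rw [hko.neg_pow, ← Nat.cast_pow] at h'; omega
    rwa [this]

section Group

variable {G : Type*} [Group G]

theorem Sylow.mem_normalizer_of_existsUnique {p : ℕ} {x g : G} {P : Sylow p G}
    (hP : ∀ Q : Sylow p G, x ∈ Q → Q = P) (hg : g * x * g⁻¹ ∈ P) :
    g ∈ Subgroup.normalizer (P : Set G) := by
  rw [← inv_mem_iff, ← Sylow.smul_eq_iff_mem_normalizer]
  refine hP _ ?_
  rw [← SetLike.mem_coe, Sylow.coe_smul, Set.mem_smul_set_iff_inv_smul_mem]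
  simpa using hg

theorem Sylow.mem_of_mem_normalizer {p : ℕ} [Fact p.Prime] {g : G} {P : Sylow p G} {k : ℕ}
    (hg : g ^ p ^ k = 1) (h : g ∈ Subgroup.normalizer (P : Set G)) : g ∈ P := by
  have hz : IsPGroup p (Subgroup.zpowers g) := by
    obtain ⟨j, -, hj⟩ := (Nat.dvd_prime_pow Fact.out).1 (orderOf_dvd_of_pow_eq_one hg)
    exact IsPGroup.of_card (by rw [Nat.card_zpowers, hj])
  have := (hz.inf_normalizer_sylow P).le ⟨Subgroup.mem_zpowers g, h⟩
  exact this.2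

theorem Sylow.eq_one_of_existsUnique {x t w : G} {P : Sylow 2 G} (hx : x ∈ P)
    (hP : ∀ Q : Sylow 2 G, x ∈ Q → Q = P) (ht : Odd (orderOf t)) (htx : Commute t x)
    (hw : w ^ 4 = 1) (hwx : w * x * w⁻¹ = x⁻¹) (hwt : w * t * w⁻¹ = t⁻¹) : t = 1 := by
  have hwP : w ∈ P := Sylow.mem_of_mem_normalizer (k := 2) hw
    (Sylow.mem_normalizer_of_existsUnique hP (by rw [hwx]; exact inv_mem hx))
  have htP : t ∈ Subgroup.normalizer (P : Set G) :=
    Sylow.mem_normalizer_of_existsUnique hP (by rwa [htx.eq, mul_inv_cancel_right])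
  have ht' : t = w * t⁻¹ * w⁻¹ := by simpa [mul_assoc] using (congrArg (·⁻¹) hwt).symm
  have h2 : t ^ 2 ∈ P := by
    have : t ^ 2 = t * w * t⁻¹ * w⁻¹ := by
      rw [sq]; nth_rw 2 [ht']; group
    rw [this]
    exact mul_mem ((Subgroup.mem_normalizer_iff.1 htP w).1 hwP) (inv_mem hwP)
  obtain ⟨k, hk⟩ := P.2 ⟨t ^ 2, h2⟩
  have hk' : t ^ 2 ^ (k + 1) = 1 := by
    rw [pow_succ', pow_mul]; simpa [Subtype.ext_iff] using hk
  rw [← orderOf_eq_one_iff]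
  exact Nat.eq_one_of_dvd_coprimes (Nat.Coprime.pow_right (k + 1) (Nat.coprime_two_right.2 ht))
    dvd_rfl (orderOf_dvd_of_pow_eq_one hk')

theorem Sylow.eq_of_isPGroup_normalizer [Finite G] {x : G} {P Q : Sylow 2 G}
    (hP : x ∈ P) (hQ : x ∈ Q) (hc : ∀ P : Sylow 2 G, Nat.card P = orderOf x * 2)
    (hN : IsPGroup 2 (Subgroup.normalizer (Subgroup.zpowers x : Set G))) : P = Q := by
  have key : ∀ P : Sylow 2 G, x ∈ P →
      Subgroup.normalizer (Subgroup.zpowers x : Set G) = P := by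
    intro P hP
    refine P.is_maximal' hN ?_
    have hle : Subgroup.zpowers x ≤ P := Subgroup.zpowers_le_of_mem hP
    rw [← Subgroup.normal_subgroupOf_iff_le_normalizer hle]
    apply Subgroup.normal_of_index_eq_two
    have h1 := Subgroup.card_mul_index ((Subgroup.zpowers x).subgroupOf P)
    have h2 := hc P
    rw [Nat.card_congr (Subgroup.subgroupOfEquivOfLe hle).toEquiv, Nat.card_zpowers] at h1
    exact Nat.eq_of_mul_eq_mul_left (orderOf_pos x) (h1.trans h2)
  exact Sylow.ext ((key P hP).symm.trans (key Q hQ))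

end Group

section SL2

open Matrix
open scoped MatrixGroups

variable {F : Type*} [Field F]

namespace Matrix

theorem SpecialLinearGroup.det_fin_two_eq (x : SL(2, F)) : x 0 0 * x 1 1 - x 0 1 * x 1 0 = 1 := by
  rw [← det_fin_two, SpecialLinearGroup.det_coe]

theorem SpecialLinearGroup.coe_inv_fin_two (x : SL(2, F)) :
    ((x⁻¹ : SL(2, F)) : Matrix (Fin 2) (Fin 2) F) = x.1.trace • 1 - x := by
  rw [SpecialLinearGroup.coe_inv, adjugate_fin_two]
  ext i j
  fin_cases i <;> fin_cases j <;> simp [trace_fin_two]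

theorem mul_self_fin_two (A : Matrix (Fin 2) (Fin 2) F) :
    A * A = A.trace • A - A.det • 1 := by
  ext i j
  fin_cases i <;> fin_cases j <;> simp [trace_fin_two, det_fin_two, mul_apply] <;> ring

theorem exists_eq_add_smul_of_commute {A B : Matrix (Fin 2) (Fin 2) F}
    (hA : ∀ c : F, A ≠ c • 1) (h : Commute B A) : ∃ α β : F, B = α • 1 + β • A := by
  have h00 := congrFun₂ h.eq 0 0
  have h01 := congrFun₂ h.eq 0 1
  have h10 := congrFun₂ h.eq 1 0
  simp only [mul_apply, Fin.sum_univ_two] at h00 h01 h10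
  by_cases h1 : A 0 1 = 0
  · by_cases h2 : A 1 0 = 0
    · have h3 : A 0 0 - A 1 1 ≠ 0 := by
        intro h3
        refine hA (A 0 0) ?_
        ext i j
        fin_cases i <;> fin_cases j <;> simp [h1, h2]
        linear_combination -h3
      refine ⟨(B 1 1 * A 0 0 - B 0 0 * A 1 1) / (A 0 0 - A 1 1),
        (B 0 0 - B 1 1) / (A 0 0 - A 1 1), ?_⟩
      ext i j
      fin_cases i <;> fin_cases j <;> simp
      · field_simp; ring
      · refine mul_left_cancel₀ h3 ?_
        rw [h1] at h01 ⊢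
        linear_combination -h01
      · refine mul_left_cancel₀ h3 ?_
        rw [h2] at h10 ⊢
        linear_combination h10
      · field_simp; ring
    · refine ⟨B 0 0 - B 1 0 / A 1 0 * A 0 0, B 1 0 / A 1 0, ?_⟩
      ext i j
      fin_cases i <;> fin_cases j <;> simp
      · field_simp; linear_combination h00
      · field_simp
      · field_simp; linear_combination h10
  · refine ⟨B 0 0 - B 0 1 / A 0 1 * A 0 0, B 0 1 / A 0 1, ?_⟩
    ext i j
    fin_cases i <;> fin_cases j <;> simp
    · field_simp
    · field_simp; linear_combination -h00
    · field_simp; linear_combination -h01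

theorem SpecialLinearGroup.inv_eq_neg_of_trace_eq_zero {w : SL(2, F)}
    (hw : w.1.trace = 0) : w⁻¹ = -w := by
  apply Subtype.ext
  rw [SpecialLinearGroup.coe_inv_fin_two, hw, SpecialLinearGroup.coe_neg]
  simp

theorem SpecialLinearGroup.conj_eq_inv_of_trace_eq_zero {w t : SL(2, F)}
    (hw : w.1.trace = 0) (hwt : (w.1 * t.1).trace = 0) :
    w * t * w⁻¹ = t⁻¹ := by
  have h1 := SpecialLinearGroup.inv_eq_neg_of_trace_eq_zero hw
  have h2 := SpecialLinearGroup.inv_eq_neg_of_trace_eq_zero (w := w * t) hwt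
  rw [h1, mul_neg, ← neg_mul, ← h2, _root_.mul_inv_rev, inv_mul_cancel_right]

theorem SpecialLinearGroup.pow_four_eq_one_of_trace_eq_zero {w : SL(2, F)}
    (hw : w.1.trace = 0) : w ^ 4 = 1 := by
  have h : w ^ 2 = -1 := by
    have := SpecialLinearGroup.inv_eq_neg_of_trace_eq_zero hw
    rw [← neg_eq_iff_eq_neg, sq, ← neg_mul, ← this, inv_mul_cancel]
  rw [show 4 = 2 * 2 from rfl, pow_mul, h, neg_one_sq]

theorem exists_pow_eq_smul_add (τ δ : F) (n : ℕ) :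
    ∃ a b : F, ∀ A : Matrix (Fin 2) (Fin 2) F,
      A.trace = τ → A.det = δ → A ^ n = a • A + b • 1 := by
  induction n with
  | zero => exact ⟨0, 1, by simp⟩
  | succ n ih =>
    obtain ⟨a, b, h⟩ := ih
    refine ⟨a * τ + b, -(a * δ), fun A h1 h2 ↦ ?_⟩
    rw [pow_succ, h A h1 h2, add_mul, smul_mul_assoc, mul_self_fin_two, h1, h2]
    simp
    module

/-- Non-scalar `2 × 2` matrices with equal trace and determinant have the same finite orders. -/
theorem pow_eq_one_of_trace_eq_of_det_eq {A B : Matrix (Fin 2) (Fin 2) F} {n : ℕ}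
    (hB : ∀ c : F, B ≠ c • 1) (ht : A.trace = B.trace) (hd : A.det = B.det) (h : B ^ n = 1) :
    A ^ n = 1 := by
  obtain ⟨a, b, hab⟩ := exists_pow_eq_smul_add B.trace B.det n
  have h1 := hab B rfl rfl
  rw [h] at h1
  have ha : a = 0 := by
    by_contra ha
    refine hB (a⁻¹ * (1 - b)) ?_
    have : a • B = (1 - b) • 1 := by rw [sub_smul, one_smul, eq_sub_iff_add_eq, ← h1]
    rw [mul_smul, ← this, inv_smul_smul₀ ha]
  rw [ha, zero_smul] at h1
  rw [hab A ht hd, ha, zero_smul, ← h1]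

theorem SpecialLinearGroup.ne_smul_one_of_not_dvd_two {x : SL(2, F)} (h : ¬ orderOf x ∣ 2)
    (c : F) : x.1 ≠ c • 1 := by
  intro hx
  have hdet := x.det_fin_two_eq
  apply h
  apply orderOf_dvd_of_pow_eq_one
  apply Subtype.ext
  simp only [hx, smul_apply, one_apply] at hdet
  simp at hdet
  rw [SpecialLinearGroup.coe_pow, hx, smul_pow, sq, hdet]
  simp

theorem SpecialLinearGroup.conj_eq_self_or_inv [NeZero (2 : F)]
    {x y : SL(2, F)} (hx : ∀ c : F, x.1 ≠ c • 1)
    (hD : (x.1.trace / 2) ^ 2 - 1 ≠ 0) (h : Commute (y * x * y⁻¹) x) :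
    y * x * y⁻¹ = x ∨ y * x * y⁻¹ = x⁻¹ := by
  have h2 : (2 : F) ≠ 0 := NeZero.ne _
  obtain ⟨α, β, hz⟩ := exists_eq_add_smul_of_commute hx (B := (y * x * y⁻¹).1)
    (congrArg Subtype.val h.eq)
  have htr : (y * x * y⁻¹).1.trace = x.1.trace := by
    change (y.1 * x.1 * (y⁻¹).1).trace = _
    rw [trace_mul_comm, ← mul_assoc]
    change ((y⁻¹ * y).1 * x.1).trace = _
    rw [_root_.inv_mul_cancel, SpecialLinearGroup.coe_one, one_mul]
  have hdet := (y * x * y⁻¹).2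
  have hxd := x.det_fin_two_eq
  rw [hz, trace_add, trace_smul, trace_smul] at htr
  rw [hz, det_fin_two] at hdet
  simp at htr hdet
  have ht := trace_fin_two x.1
  set s := x.1.trace / 2 with hs
  have hts : x.1.trace = 2 * s := by rw [hs]; field_simp
  rw [hts] at ht htr
  have hα : α = s - β * s := by
    apply mul_left_cancel₀ h2
    linear_combination htr
  subst hα
  have hβ : (β - 1) * (β + 1) * (s ^ 2 - 1) = 0 := by
    linear_combination -hdet + β ^ 2 * hxd - β * (s - β * s) * ht
  rcases mul_eq_zero.1 ((mul_eq_zero.1 hβ).resolve_right hD) with hβ | hβ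
  · left
    apply Subtype.ext
    rw [hz, sub_eq_zero.1 hβ]
    simp
  · right
    apply Subtype.ext
    rw [hz, eq_neg_of_add_eq_zero_left hβ, SpecialLinearGroup.coe_inv_fin_two, hts]
    module

variable [Fintype F]

theorem add_pow_card_of_commute {A B : Matrix (Fin 2) (Fin 2) F} (h : Commute A B) :
    (A + B) ^ Fintype.card F = A ^ Fintype.card F + B ^ Fintype.card F := by
  obtain ⟨p, hp⟩ := CharP.exists F
  obtain ⟨n, hpp, hn⟩ := FiniteField.card F p
  have : Fact p.Prime := ⟨hpp⟩
  rw [hn]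
  exact add_pow_char_pow_of_commute p n h

theorem smul_one_add_smul_pow_card (α β : F) (A : Matrix (Fin 2) (Fin 2) F) :
    (α • 1 + β • A) ^ Fintype.card F = α • 1 + β • A ^ Fintype.card F := by
  rw [add_pow_card_of_commute ((Commute.one_left _).smul_left α), smul_pow, smul_pow, one_pow,
    FiniteField.pow_card, FiniteField.pow_card]

theorem pow_card_eq [NeZero (2 : F)] (hodd : Odd (Fintype.card F)) {A : Matrix (Fin 2) (Fin 2) F}
    (hA : A.det = 1) :
    A ^ Fintype.card F = (A.trace / 2) • 1 +
      ((A.trace / 2) ^ 2 - 1) ^ (Fintype.card F / 2) • (A - (A.trace / 2) • 1) := by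
  have h2 : (2 : F) ≠ 0 := NeZero.ne _
  set s := A.trace / 2 with hs
  have hsq : (A - s • 1) ^ 2 = (s ^ 2 - 1) • 1 := by
    have ht : A.trace = 2 * s := by rw [hs]; field_simp
    rw [sq, sub_mul, mul_sub, mul_self_fin_two, hA, ht]
    simp
    module
  have hpow : (A - s • 1) ^ Fintype.card F =
      (s ^ 2 - 1) ^ (Fintype.card F / 2) • (A - s • 1) := by
    conv_lhs => rw [← Nat.two_mul_div_two_add_one_of_odd hodd]
    rw [pow_succ, pow_mul, hsq, smul_pow, one_pow, smul_one_mul]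
  have := smul_one_add_smul_pow_card s 1 (A - s • 1)
  rw [one_smul, hpow, one_smul] at this
  rwa [add_sub_cancel] at this

theorem exists_neg_sq_add_mul_sq_eq_one (hodd : Odd (Fintype.card F)) {D : F} (hD : D ≠ 0) :
    ∃ a b : F, -a ^ 2 + D * b ^ 2 = 1 := by
  open Polynomial in
  obtain ⟨a, b, h⟩ := FiniteField.exists_root_sum_quadratic (R := F)
    (f := C (-1) * X ^ 2 + C 0 * X + C 0) (g := C D * X ^ 2 + C 0 * X + C (-1))
    (degree_quadratic (by simp)) (degree_quadratic hD) (Nat.odd_iff.1 hodd)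
  refine ⟨a, b, ?_⟩
  simp at h
  linear_combination h

theorem SpecialLinearGroup.exists_trace_eq_zero [NeZero (2 : F)] (hodd : Odd (Fintype.card F))
    {x : SL(2, F)} (hD : (x.1.trace / 2) ^ 2 - 1 ≠ 0) :
    ∃ w : SL(2, F), w.1.trace = 0 ∧ (w.1 * x.1).trace = 0 := by
  have h2 : (2 : F) ≠ 0 := NeZero.ne _
  obtain ⟨a, v, h⟩ := exists_neg_sq_add_mul_sq_eq_one hodd hD
  have hdet := x.det_fin_two_eq
  rw [trace_fin_two] at h
  by_cases hb : x 0 1 = 0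
  · by_cases hc : x 1 0 = 0
    · refine ⟨⟨!![0, 1; -1, 0], by simp [det_fin_two]⟩, by simp [trace_fin_two], ?_⟩
      rw [trace_fin_two, mul_apply, mul_apply]
      simp [hb, hc]
    · refine ⟨⟨!![a + (x 0 0 - x 1 1) * v / 2,
        -(a * (x 0 0 - x 1 1) + (x 0 0 - x 1 1) ^ 2 * v / 2 + x 0 1 * x 1 0 * v) / x 1 0;
        x 1 0 * v, -(a + (x 0 0 - x 1 1) * v / 2)], ?_⟩, by simp [trace_fin_two], ?_⟩
      · rw [det_fin_two]
        simp
        field_simp at h ⊢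
        linear_combination h - 4 * v ^ 2 * hdet
      · rw [trace_fin_two, mul_apply, mul_apply]
        simp
        field_simp
        ring
  · refine ⟨⟨!![a + (x 0 0 - x 1 1) * v / 2, x 0 1 * v;
        -(a * (x 0 0 - x 1 1) + (x 0 0 - x 1 1) ^ 2 * v / 2 + x 0 1 * x 1 0 * v) / x 0 1,
        -(a + (x 0 0 - x 1 1) * v / 2)], ?_⟩, by simp [trace_fin_two], ?_⟩
    · rw [det_fin_two]
      simp
      field_simp at h ⊢
      linear_combination h - 4 * v ^ 2 * hdet
    · rw [trace_fin_two, mul_apply, mul_apply]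
      simp
      field_simp
      ring

namespace SpecialLinearGroup

variable [NeZero (2 : F)]

theorem discr_ne_zero_of_coprime (hodd : Odd (Fintype.card F)) {x : SL(2, F)}
    (hx : ∀ c : F, x.1 ≠ c • 1) (hc : (orderOf x).Coprime (Fintype.card F)) :
    (x.1.trace / 2) ^ 2 - 1 ≠ 0 := by
  intro hD
  have h0 : Fintype.card F / 2 ≠ 0 := by
    have := Fintype.one_lt_card (α := F)
    omega
  have h := pow_card_eq hodd x.2
  rw [hD, zero_pow h0, zero_smul, add_zero] at h
  obtain ⟨m, hm⟩ := exists_pow_eq_self_of_coprime hc.symm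
  refine hx ((x.1.trace / 2) ^ m) ?_
  conv_lhs => rw [← hm]
  rw [SpecialLinearGroup.coe_pow, SpecialLinearGroup.coe_pow, h, smul_pow, one_pow]

/-- The `q`-th power of a semisimple element. -/
theorem pow_card_eq_self_or_inv (hodd : Odd (Fintype.card F)) {x : SL(2, F)}
    (hD : (x.1.trace / 2) ^ 2 - 1 ≠ 0) :
    (((x.1.trace / 2) ^ 2 - 1) ^ (Fintype.card F / 2) = 1 ∧ x ^ Fintype.card F = x) ∨
    (((x.1.trace / 2) ^ 2 - 1) ^ (Fintype.card F / 2) = -1 ∧ x ^ Fintype.card F = x⁻¹) := by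
  have hF : ringChar F ≠ 2 := fun h ↦ by
    have := FiniteField.even_card_of_char_two h
    rw [Nat.odd_iff] at hodd
    omega
  have h := pow_card_eq hodd x.2
  refine (FiniteField.pow_dichotomy hF hD).imp (fun h1 ↦ ⟨h1, ?_⟩) (fun h1 ↦ ⟨h1, ?_⟩)
  · apply Subtype.ext
    rw [SpecialLinearGroup.coe_pow, h, h1]
    module
  · apply Subtype.ext
    rw [SpecialLinearGroup.coe_pow, h, h1, coe_inv_fin_two]
    have h2 : (2 : F) ≠ 0 := NeZero.ne _
    have ht : x.1.trace = x.1.trace / 2 + x.1.trace / 2 := by field_simp; ring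
    conv_rhs => rw [ht]
    module

/-- If `x` and `y` are semisimple of the same type, the torus of `x` contains an element with
the trace of `y`. -/
theorem exists_commute_orderOf_eq (hodd : Odd (Fintype.card F)) {x y : SL(2, F)} {r : ℕ}
    [Fact r.Prime] (hx : ∀ c : F, x.1 ≠ c • 1) (hy : ∀ c : F, y.1 ≠ c • 1)
    (hr : orderOf y = r) (hDx : (x.1.trace / 2) ^ 2 - 1 ≠ 0) (hDy : (y.1.trace / 2) ^ 2 - 1 ≠ 0)
    (h : ((x.1.trace / 2) ^ 2 - 1) ^ (Fintype.card F / 2) =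
      ((y.1.trace / 2) ^ 2 - 1) ^ (Fintype.card F / 2)) :
    ∃ (t : SL(2, F)) (α β : F), t.1 = α • 1 + β • x.1 ∧ orderOf t = r := by
  have hF : ringChar F ≠ 2 := fun h ↦ by
    have := FiniteField.even_card_of_char_two h
    rw [Nat.odd_iff] at hodd
    omega
  obtain ⟨c, hc⟩ := (FiniteField.isSquare_iff hF (div_ne_zero hDy hDx)).2
    (by rw [div_pow, h, div_self (pow_ne_zero _ hDy)])
  have h2 : (2 : F) ≠ 0 := NeZero.ne _
  rw [div_eq_iff hDx] at hc
  have hc0 : c ≠ 0 := by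
    rintro rfl
    simp at hc
    exact hDy hc
  have hdet := x.det_fin_two_eq
  have htr := trace_fin_two x.1
  set s := x.1.trace / 2 with hs
  set s' := y.1.trace / 2 with hs'
  have hts : x.1.trace = 2 * s := by rw [hs]; field_simp
  have hts' : y.1.trace = 2 * s' := by rw [hs']; field_simp
  rw [hts] at htr
  have hdt : ((s' - c * s) • (1 : Matrix (Fin 2) (Fin 2) F) + c • x.1).det = 1 := by
    rw [det_fin_two]
    simp
    linear_combination hc + c ^ 2 * hdet - c * (s' - c * s) * htr
  refine ⟨⟨_, hdt⟩, s' - c * s, c, rfl, ?_⟩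
  apply orderOf_eq_prime
  · apply Subtype.ext
    change ((s' - c * s) • 1 + c • x.1) ^ r = 1
    refine pow_eq_one_of_trace_eq_of_det_eq hy ?_ (hdt.trans y.2.symm) ?_
    · rw [hts', trace_fin_two]
      simp
      linear_combination -c * htr
    · rw [← SpecialLinearGroup.coe_pow, ← hr, pow_orderOf_eq_one, SpecialLinearGroup.coe_one]
  · intro h1
    have h1 : (s' - c * s) • (1 : Matrix (Fin 2) (Fin 2) F) + c • x.1 = 1 :=
      congrArg Subtype.val h1
    refine hx (c⁻¹ * (1 - (s' - c * s))) ?_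
    rw [mul_smul, sub_smul, one_smul, eq_inv_smul_iff₀ hc0, eq_sub_iff_add_eq, add_comm, h1]

/-- A picky semisimple `2`-element forces its maximal torus to be a `2`-group. -/
theorem not_dvd_of_picky (hodd : Odd (Fintype.card F)) {x y : SL(2, F)} {r : ℕ}
    [Fact r.Prime] (hr2 : Odd r) (hx : ∀ c : F, x.1 ≠ c • 1) (hy : ∀ c : F, y.1 ≠ c • 1)
    (hr : orderOf y = r)
    (hDx : (x.1.trace / 2) ^ 2 - 1 ≠ 0) (hDy : (y.1.trace / 2) ^ 2 - 1 ≠ 0)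
    (h : ((x.1.trace / 2) ^ 2 - 1) ^ (Fintype.card F / 2) =
      ((y.1.trace / 2) ^ 2 - 1) ^ (Fintype.card F / 2)) {P : Sylow 2 SL(2, F)} (hxP : x ∈ P)
    (hP : ∀ Q : Sylow 2 SL(2, F), x ∈ Q → Q = P) : False := by
  obtain ⟨t, α, β, ht, hto⟩ := exists_commute_orderOf_eq hodd hx hy hr hDx hDy h
  obtain ⟨w, hw, hwx⟩ := exists_trace_eq_zero hodd hDx
  have hwt : (w.1 * t.1).trace = 0 := by
    rw [ht, mul_add, trace_add, mul_smul_comm, mul_smul_comm, trace_smul, trace_smul, hwx, mul_one,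
      hw, smul_zero, smul_zero, add_zero]
  have htx : Commute t x := by
    apply Subtype.ext
    change t.1 * x.1 = x.1 * t.1
    rw [ht, add_mul, mul_add]
    simp
  have := Sylow.eq_one_of_existsUnique hxP hP (by rwa [hto]) htx
    (pow_four_eq_one_of_trace_eq_zero hw) (conj_eq_inv_of_trace_eq_zero hw hwx)
    (conj_eq_inv_of_trace_eq_zero hw hwt)
  rw [this, orderOf_one] at hto
  exact (Fact.out : r.Prime).one_lt.ne hto

end SpecialLinearGroup

namespace SpecialLinearGroup

theorem natCard_fin_two : Nat.card SL(2, F) =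
    Fintype.card F * ((Fintype.card F - 1) * (Fintype.card F + 1)) := by
  classical
  have e : SL(2, F) ≃ (GeneralLinearGroup.det (n := Fin 2) (R := F)).ker :=
    { toFun x := ⟨x, by rw [MonoidHom.mem_ker]; ext; simp⟩
      invFun g := ⟨g.1.1, by simpa using congrArg Units.val (MonoidHom.mem_ker.1 g.2)⟩
      left_inv x := rfl
      right_inv g := by ext; rfl }
  have hs : Function.Surjective (GeneralLinearGroup.det (n := Fin 2) (R := F)) := fun u ↦
    ⟨GeneralLinearGroup.mkOfDetNeZero !![u.1, 0; 0, 1] (by simp [det_fin_two]),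
      by ext; simp [GeneralLinearGroup.mkOfDetNeZero, det_fin_two]⟩
  have h := Subgroup.card_mul_index (GeneralLinearGroup.det (n := Fin 2) (R := F)).ker
  rw [Subgroup.index_ker, MonoidHom.range_eq_top.2 hs, ← Nat.card_congr e, card_GL_field,
    Subgroup.card_top, Nat.card_units, Nat.card_eq_fintype_card (α := F), Fin.prod_univ_two] at h
  have h1 := Fintype.one_lt_card (α := F)
  obtain ⟨n, hn⟩ := Nat.exists_eq_add_of_lt h1
  have e1 : Fintype.card F - 1 = n + 1 := by omega
  have e2 : Fintype.card F = n + 2 := by omega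
  rw [e1] at h ⊢
  rw [e2] at h ⊢
  have e3 : (n + 2) ^ 2 - (n + 2) ^ ((0 : Fin 2) : ℕ) = (n + 1) * (n + 2 + 1) := by
    rw [Nat.sub_eq_iff_eq_add (Nat.pow_le_pow_right (by omega) (by simp))]; simp; ring
  have e4 : (n + 2) ^ 2 - (n + 2) ^ ((1 : Fin 2) : ℕ) = (n + 1) * (n + 2) := by
    rw [Nat.sub_eq_iff_eq_add (Nat.pow_le_pow_right (by omega) (by simp))]; simp; ring
  rw [e3, e4] at h
  refine Nat.eq_of_mul_eq_mul_right (Nat.succ_pos n) (h.trans ?_)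
  simp only [Nat.succ_eq_add_one]
  ring

theorem exists_orderOf_eq_card_sub_one : ∃ x : SL(2, F), orderOf x = Fintype.card F - 1 := by
  classical
  obtain ⟨g, hg⟩ := IsCyclic.exists_ofOrder_eq_natCard (α := Fˣ)
  let f : Fˣ →* SL(2, F) :=
    { toFun u := ⟨!![u.1, 0; 0, (u⁻¹).1], by simp [det_fin_two]⟩
      map_one' := by ext i j; fin_cases i <;> fin_cases j <;> simp
      map_mul' u v := Subtype.ext (by
        change _ = !![u.1, 0; 0, (u⁻¹).1] * !![v.1, 0; 0, (v⁻¹).1]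
        ext i j; fin_cases i <;> fin_cases j <;> simp [mul_comm]) }
  refine ⟨f g, ?_⟩
  rw [orderOf_injective f, hg, Nat.card_units, Nat.card_eq_fintype_card]
  intro u v h
  ext
  exact congrFun₂ (congrArg Subtype.val h) 0 0

theorem exists_orderOf_eq_card_add_one : ∃ x : SL(2, F), orderOf x = Fintype.card F + 1 := by
  classical
  obtain ⟨p, hp⟩ := CharP.exists F
  have : Fact p.Prime := ⟨CharP.char_is_prime F p⟩
  have h1 := Fintype.one_lt_card (α := F)
  set L := FiniteField.Extension F p 2
  have : Fintype L := Fintype.ofFinite L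
  have hL : Nat.card L - 1 = (Fintype.card F - 1) * (Fintype.card F + 1) := by
    rw [FiniteField.natCard_extension, Nat.card_eq_fintype_card, mul_comm, ← Nat.sq_sub_sq,
      one_pow]
  obtain ⟨g, hg⟩ := IsCyclic.exists_ofOrder_eq_natCard (α := Lˣ)
  rw [Nat.card_units, hL] at hg
  let b : Module.Basis (Fin 2) F L :=
    Module.finBasisOfFinrankEq F L (FiniteField.finrank_extension F p 2)
  let u : L := (g ^ (Fintype.card F - 1) : Lˣ)
  have hu : orderOf u = Fintype.card F + 1 := by
    rw [orderOf_units, orderOf_pow, hg, Nat.gcd_mul_right_left,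
      Nat.mul_div_cancel_left _ (by omega)]
  have hdet : (Algebra.leftMulMatrix b u).det = 1 := by
    rw [← Algebra.norm_eq_matrix_det]
    apply (algebraMap F L).injective
    rw [FiniteField.algebraMap_norm_eq_pow, hL, Nat.card_eq_fintype_card,
      Nat.mul_div_cancel_left _ (by omega), ← hu, pow_orderOf_eq_one, map_one]
  let x : SL(2, F) := ⟨_, hdet⟩
  have hx := orderOf_injective (coeMonoidHom : SL(2, F) →* Matrix (Fin 2) (Fin 2) F)
    coeMonoidHom_injective x
  exact ⟨x, hx.symm.trans ((orderOf_injective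
    (Algebra.leftMulMatrix b : L →* Matrix (Fin 2) (Fin 2) F)
    (Algebra.leftMulMatrix_injective b) u).trans hu)⟩

theorem card_sylow_two {N m : ℕ} (hm : 2 ≤ m) (hN : N = 2 ^ m)
    (h : N = Fintype.card F - 1 ∨ N = Fintype.card F + 1)
    (P : Sylow 2 SL(2, F)) : Nat.card P = N * 2 := by
  rw [Sylow.card_eq_multiplicity, natCard_fin_two]
  have h1 := Fintype.one_lt_card (α := F)
  have h4 : 4 ∣ N := hN ▸ pow_dvd_pow 2 hm
  obtain ⟨c, hc, hcard⟩ : ∃ c, Odd c ∧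
      Fintype.card F * ((Fintype.card F - 1) * (Fintype.card F + 1)) = 2 ^ (m + 1) * c := by
    rcases h with h | h
    · obtain ⟨j, hj⟩ : ∃ j, Fintype.card F + 1 = 2 * j :=
        ⟨(Fintype.card F + 1) / 2, by omega⟩
      refine ⟨Fintype.card F * j,
        Odd.mul (Nat.odd_iff.2 (by omega)) (Nat.odd_iff.2 (by omega)), ?_⟩
      rw [← h, hj, pow_succ, ← hN]
      ring
    · obtain ⟨j, hj⟩ : ∃ j, Fintype.card F - 1 = 2 * j :=
        ⟨(Fintype.card F - 1) / 2, by omega⟩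
      refine ⟨Fintype.card F * j,
        Odd.mul (Nat.odd_iff.2 (by omega)) (Nat.odd_iff.2 (by omega)), ?_⟩
      rw [← h, hj, pow_succ, ← hN]
      ring
  have hc2 : c.factorization 2 = 0 := Nat.factorization_eq_zero_of_not_dvd (by
    rwa [← even_iff_two_dvd, Nat.not_even_iff_odd])
  rw [hcard, Nat.factorization_mul (by positivity) hc.pos.ne', Finsupp.add_apply, hc2,
    Nat.Prime.factorization_pow Nat.prime_two, Finsupp.single_eq_same, add_zero, pow_succ, hN]

variable [NeZero (2 : F)]

theorem isPGroup_normalizer_zpowers {x : SL(2, F)} {m : ℕ}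
    (hx : ∀ c : F, x.1 ≠ c • 1) (hD : (x.1.trace / 2) ^ 2 - 1 ≠ 0)
    (h : Fintype.card F = 2 ^ m + 1 ∧ x ^ Fintype.card F = x ∨
      Fintype.card F + 1 = 2 ^ m ∧ x ^ Fintype.card F = x⁻¹) :
    IsPGroup 2 (Subgroup.normalizer (Subgroup.zpowers x : Set SL(2, F))) := by
  rintro ⟨y, hy⟩
  refine ⟨m + 1, Subtype.ext ?_⟩
  change y ^ 2 ^ (m + 1) = 1
  have hcx : Commute (y * x * y⁻¹) x := by
    obtain ⟨k, hk⟩ := (Subgroup.mem_normalizer_iff.1 hy x).1 (Subgroup.mem_zpowers x)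
    rw [← hk]
    exact (Commute.refl x).zpow_left k
  have hy2 : Commute (y ^ 2) x := by
    rw [Commute, SemiconjBy, ← mul_inv_eq_iff_eq_mul]
    have e : y ^ 2 * x * (y ^ 2)⁻¹ = y * (y * x * y⁻¹) * y⁻¹ := by
      simp only [sq, _root_.mul_inv_rev, mul_assoc]
    rcases conj_eq_self_or_inv hx hD hcx with h | h
    · rw [e, h, h]
    · rw [e, h]
      simpa [mul_assoc] using congrArg (·⁻¹) h
  obtain ⟨α, β, hz⟩ := exists_eq_add_smul_of_commute hx (B := (y ^ 2).1)
    (congrArg Subtype.val hy2.eq)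
  have hpow := smul_one_add_smul_pow_card α β x.1
  rw [← hz, ← coe_pow, ← coe_pow] at hpow
  rw [pow_succ', pow_mul]
  rcases h with ⟨hq, h⟩ | ⟨hq, h⟩
  · have : (y ^ 2) ^ Fintype.card F = y ^ 2 := Subtype.ext (by rw [hpow, h, hz])
    rwa [hq, pow_succ, mul_eq_right] at this
  · have : (y ^ 2) ^ Fintype.card F = (y ^ 2)⁻¹ := Subtype.ext (by
      rw [hpow, h, coe_inv_fin_two, coe_inv_fin_two, hz, trace_add, trace_smul, trace_smul]
      simp
      module)
    rw [← hq, pow_succ, this, inv_mul_cancel]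

theorem exists_picky {m : ℕ} (hm : 2 ≤ m)
    (h : Fintype.card F = 2 ^ m + 1 ∨ Fintype.card F + 1 = 2 ^ m) :
    ∃ x : SL(2, F), (∃ k : ℕ, orderOf x = 2 ^ k) ∧ ∃! P : Sylow 2 SL(2, F), x ∈ P := by
  have h4 : 4 ∣ 2 ^ m := pow_dvd_pow 2 hm
  have hpos : 0 < 2 ^ m := by positivity
  have hodd : Odd (Fintype.card F) := Nat.odd_iff.2 (by omega)
  obtain ⟨x, hx⟩ : ∃ x : SL(2, F), orderOf x = 2 ^ m := by
    rcases h with h | h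
    · simpa [h] using exists_orderOf_eq_card_sub_one (F := F)
    · simpa [h] using exists_orderOf_eq_card_add_one (F := F)
  have hs : ∀ c : F, x.1 ≠ c • 1 := ne_smul_one_of_not_dvd_two (by
    rw [hx]
    intro h2
    have := Nat.le_of_dvd two_pos h2
    omega)
  have hD := discr_ne_zero_of_coprime hodd hs
    (by rw [hx]; exact (Nat.coprime_two_left.2 hodd).pow_left m)
  have hN := isPGroup_normalizer_zpowers (m := m) hs hD (by
    refine h.imp (fun h ↦ ⟨h, ?_⟩) (fun h ↦ ⟨h, ?_⟩)
    · rw [h, pow_succ, ← hx, pow_orderOf_eq_one, one_mul]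
    · rw [eq_inv_iff_mul_eq_one, ← pow_succ, h, ← hx, pow_orderOf_eq_one])
  obtain ⟨P, hP⟩ := (IsPGroup.of_card (p := 2) (G := Subgroup.zpowers x)
    (by rw [Nat.card_zpowers, hx])).exists_le_sylow
  have hxP : x ∈ P := hP (Subgroup.mem_zpowers x)
  exact ⟨x, ⟨m, hx⟩, P, hxP, fun Q hQ ↦ Sylow.eq_of_isPGroup_normalizer hQ hxP
    (fun P ↦ card_sylow_two hm hx (by omega) P) hN⟩

theorem exists_orderOf_eq_prime (hodd : Odd (Fintype.card F)) {r : ℕ} (hr : r.Prime) (hr2 : Odd r)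
    (h : r ∣ Fintype.card F - 1 ∨ r ∣ Fintype.card F + 1) :
    ∃ y : SL(2, F), orderOf y = r ∧ (∀ c : F, y.1 ≠ c • 1) ∧
      (y.1.trace / 2) ^ 2 - 1 ≠ 0 ∧
      (r ∣ Fintype.card F - 1 → ((y.1.trace / 2) ^ 2 - 1) ^ (Fintype.card F / 2) = 1) ∧
      (r ∣ Fintype.card F + 1 → ((y.1.trace / 2) ^ 2 - 1) ^ (Fintype.card F / 2) = -1) := by
  have := Fact.mk hr
  have h1 := Fintype.one_lt_card (α := F)
  have hr1 := hr.two_le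
  have hr3 : ¬ r ∣ 2 := fun h ↦ by
    have := Nat.le_of_dvd two_pos h
    obtain rfl : r = 2 := by omega
    exact absurd hr2 (by decide)
  have hndvd : ¬ (r ∣ Fintype.card F - 1 ∧ r ∣ Fintype.card F + 1) := fun ⟨ha, hb⟩ ↦ by
    refine hr3 ?_
    have := Nat.dvd_sub hb ha
    rwa [show Fintype.card F + 1 - (Fintype.card F - 1) = 2 by omega] at this
  have hcop : r.Coprime (Fintype.card F) := by
    rw [hr.coprime_iff_not_dvd]
    intro hd
    refine hr.one_lt.ne' (Nat.dvd_one.1 ?_)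
    rcases h with h | h
    · have := Nat.dvd_sub hd h
      rwa [Nat.sub_sub_self h1.le] at this
    · exact (Nat.dvd_add_right hd).1 h
  obtain ⟨y, hy⟩ := exists_prime_orderOf_dvd_card' (G := SL(2, F)) r (by
    rw [natCard_fin_two]
    exact (h.elim (·.mul_right _) (·.mul_left _)).mul_left _)
  have hs := ne_smul_one_of_not_dvd_two (hy ▸ hr3)
  have hD := discr_ne_zero_of_coprime hodd hs (hy ▸ hcop)
  refine ⟨y, hy, hs, hD, ?_⟩
  rcases pow_card_eq_self_or_inv hodd hD with ⟨h2, h3⟩ | ⟨h2, h3⟩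
  · refine ⟨fun _ ↦ h2, fun h ↦ (hndvd ⟨?_, h⟩).elim⟩
    rw [← hy]
    apply orderOf_dvd_of_pow_eq_one
    rwa [← Nat.sub_add_cancel h1.le, pow_succ, mul_eq_right] at h3
  · refine ⟨fun h ↦ (hndvd ⟨h, ?_⟩).elim, fun _ ↦ h2⟩
    rw [← hy]
    apply orderOf_dvd_of_pow_eq_one
    rw [pow_succ, h3, inv_mul_cancel]

theorem card_eq_of_picky_of_not_scalar (hodd : Odd (Fintype.card F)) {x : SL(2, F)} {k : ℕ}
    (hk : orderOf x = 2 ^ k) (hx : ∀ c : F, x.1 ≠ c • 1) {P : Sylow 2 SL(2, F)}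
    (hxP : x ∈ P) (hP : ∀ Q : Sylow 2 SL(2, F), x ∈ Q → Q = P) :
    ∃ m, Fintype.card F = 2 ^ m + 1 ∨ Fintype.card F + 1 = 2 ^ m := by
  have h1 := Fintype.one_lt_card (α := F)
  have hD := discr_ne_zero_of_coprime hodd hx
    (by rw [hk]; exact (Nat.coprime_two_left.2 hodd).pow_left k)
  rcases pow_card_eq_self_or_inv hodd hD with ⟨h2, -⟩ | ⟨h2, -⟩
  · have := Nat.eq_prime_pow_of_unique_prime_dvd (n := Fintype.card F - 1) (p := 2) (by omega) (by
      intro r hr hd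
      by_contra hr2
      have hro := hr.odd_of_ne_two hr2
      have := Fact.mk hr
      obtain ⟨y, hy, hys, hyD, hχ, -⟩ := exists_orderOf_eq_prime hodd hr hro (.inl hd)
      exact not_dvd_of_picky hodd hro hx hys hy hD hyD (h2.trans (hχ hd).symm) hxP hP)
    exact ⟨_, .inl (by rw [← this, Nat.sub_add_cancel h1.le])⟩
  · have := Nat.eq_prime_pow_of_unique_prime_dvd (n := Fintype.card F + 1) (p := 2) (by omega) (by
      intro r hr hd
      by_contra hr2
      have hro := hr.odd_of_ne_two hr2
      have := Fact.mk hr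
      obtain ⟨y, hy, hys, hyD, -, hχ⟩ := exists_orderOf_eq_prime hodd hr hro (.inr hd)
      exact not_dvd_of_picky hodd hro hx hys hy hD hyD (h2.trans (hχ hd).symm) hxP hP)
    exact ⟨_, .inr this⟩

theorem card_eq_of_picky (hodd : Odd (Fintype.card F)) {x : SL(2, F)}
    (hk : ∃ k : ℕ, orderOf x = 2 ^ k) (h : ∃! P : Sylow 2 SL(2, F), x ∈ P) :
    ∃ m, Fintype.card F = 2 ^ m + 1 ∨ Fintype.card F + 1 = 2 ^ m := by
  obtain ⟨P, hxP, hP⟩ := h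
  by_cases hx : ∀ c : F, x.1 ≠ c • 1
  · obtain ⟨k, hk⟩ := hk
    exact card_eq_of_picky_of_not_scalar hodd hk hx hxP hP
  · push Not at hx
    obtain ⟨c, hc⟩ := hx
    have hconj (g : SL(2, F)) : g * x * g⁻¹ = x := by
      rw [mul_inv_eq_iff_eq_mul]
      apply Subtype.ext
      change g.1 * x.1 = x.1 * g.1
      simp [hc]
    have hall (Q : Sylow 2 SL(2, F)) : Q = P := by
      obtain ⟨g, rfl⟩ := MulAction.exists_smul_eq SL(2, F) P Q
      rw [Sylow.smul_eq_iff_mem_normalizer]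
      exact Sylow.mem_normalizer_of_existsUnique hP (by rwa [hconj])
    let w : SL(2, F) := ⟨!![0, 1; -1, 0], by simp [det_fin_two]⟩
    have hw : orderOf w ∣ 2 ^ 2 :=
      orderOf_dvd_of_pow_eq_one (pow_four_eq_one_of_trace_eq_zero (by simp [w, trace_fin_two]))
    obtain ⟨k, -, hk⟩ := (Nat.dvd_prime_pow Nat.prime_two).1 hw
    obtain ⟨Q, hQ⟩ := (IsPGroup.of_card (p := 2) (G := Subgroup.zpowers w)
      (by rw [Nat.card_zpowers, hk])).exists_le_sylow
    refine card_eq_of_picky_of_not_scalar hodd hk (fun c hc ↦ ?_) (hQ (Subgroup.mem_zpowers w))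
      (fun R _ ↦ (hall R).trans (hall Q).symm)
    simpa [w] using congrFun₂ hc 0 1

end SpecialLinearGroup

end Matrix

end SL2

/-- For `q ≥ 5` an odd prime power, `SL_2(𝔽_q)` contains a picky `2`-element
if and only if `q` is a Fermat or Mersenne prime, or `q = 9`. -/
theorem picky_two_element_SL2_iff
    (q : ℕ) (hq : IsPrimePow q) (hodd : Odd q) (hq5 : 5 ≤ q)
    (F : Type*) [Field F] [Fintype F] [DecidableEq F] (hF : Fintype.card F = q) :
    (∃ x : Matrix.SpecialLinearGroup (Fin 2) F,
        (∃ k : ℕ, orderOf x = 2 ^ k) ∧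
          ∃! P : Sylow 2 (Matrix.SpecialLinearGroup (Fin 2) F), x ∈ P) ↔
      (IsFermatPrime q ∨ IsMersennePrime q ∨ q = 9) := by
  have hchar : ringChar F ≠ 2 := fun h ↦ by
    have := FiniteField.even_card_of_char_two h
    rw [hF] at this
    rw [Nat.odd_iff] at hodd
    omega
  have : NeZero (2 : F) := ⟨Ring.two_ne_zero hchar⟩
  constructor
  · rintro ⟨x, hk, hx⟩
    obtain ⟨m, hm | hm⟩ := Matrix.SpecialLinearGroup.card_eq_of_picky (by rwa [hF]) hk hx
    · rw [hF] at hm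
      exact (prime_or_eq_nine_of_eq_two_pow_add_one hq hodd hm).imp (⟨·, m, hm⟩) .inr
    · rw [hF] at hm
      exact .inr (.inl ⟨prime_of_add_one_eq_two_pow hq hodd (by omega) hm, m, by omega⟩)
  · intro h
    obtain ⟨m, hm⟩ : ∃ m, q = 2 ^ m + 1 ∨ q + 1 = 2 ^ m := by
      rcases h with ⟨-, m, h⟩ | ⟨-, m, h⟩ | h
      · exact ⟨m, .inl h⟩
      · exact ⟨m, .inr (by omega)⟩
      · exact ⟨3, .inl h⟩
    have hm2 : 2 ≤ m := by
      by_contra hlt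
      have := Nat.pow_le_pow_right (n := 2) two_pos (show m ≤ 1 by omega)
      omega
    exact Matrix.SpecialLinearGroup.exists_picky hm2 (by rwa [hF])
end

section
/- Let q be an odd prime power. Then Sp_4(𝔽_q) contains a picky 2-element if and only if q ∉ {5, 7} and q is a Fermat prime or a Mersenne prime. -/
/-! ### Picky elements, without reference to Sylow subgroups -/

section Picky

variable {G H : Type*} [Group G] [Group H]

/-- `P` is a `2`-subgroup containing `x` and every `2`-subgroup containing `x`. -/
structure IsTopTwoSubgroup (x : G) (P : Subgroup G) : Prop where
  isPGroup : IsPGroup 2 P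
  mem : x ∈ P
  le : ∀ Q : Subgroup G, IsPGroup 2 Q → x ∈ Q → Q ≤ P

theorem existsUnique_sylow_two_iff (x : G) :
    (∃! P : Sylow 2 G, x ∈ P) ↔ ∃ P : Subgroup G, IsTopTwoSubgroup x P := by
  constructor
  · rintro ⟨P, hP, hu⟩
    refine ⟨P, P.isPGroup', hP, fun Q hQ hx => ?_⟩
    obtain ⟨S, hS⟩ := hQ.exists_le_sylow
    rw [← hu S (hS hx)]
    exact hS
  · rintro ⟨P, hP⟩
    refine ⟨⟨P, hP.isPGroup, fun hQ hle => le_antisymm (hP.le _ hQ (hle hP.mem)) hle⟩,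
      hP.mem, fun S hS => ?_⟩
    ext1
    exact (S.is_maximal' hP.isPGroup (hP.le _ S.isPGroup' hS)).symm

theorem isPGroup_zpowers {y : G} {k : ℕ} (hy : y ^ 2 ^ k = 1) :
    IsPGroup 2 (Subgroup.zpowers y) := by
  rintro ⟨_, n, rfl⟩
  refine ⟨k, Subtype.ext ?_⟩
  change (y ^ n) ^ 2 ^ k = 1
  rw [← zpow_natCast, ← zpow_mul, mul_comm, zpow_mul, zpow_natCast, hy, one_zpow]

theorem IsPGroup.exists_pow_eq_one {P : Subgroup G} (hP : IsPGroup 2 P) {y : G} (hy : y ∈ P) :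
    ∃ k : ℕ, y ^ 2 ^ k = 1 := by
  obtain ⟨k, hk⟩ := hP ⟨y, hy⟩
  exact ⟨k, congrArg Subtype.val hk⟩

theorem exists_pow_three_pow_eq_self {M : Type*} [Monoid M] {y : M} {k : ℕ}
    (hy : y ^ 2 ^ k = 1) : ∃ m : ℕ, (y ^ 3) ^ m = y :=
  exists_pow_eq_self_of_coprime <| Nat.Coprime.coprime_dvd_right (orderOf_dvd_of_pow_eq_one hy)
    (Nat.Coprime.pow_right k (by norm_num))

namespace IsTopTwoSubgroup

variable {x y : G} {P : Subgroup G}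

theorem map (h : IsTopTwoSubgroup x P) (e : G ≃* H) :
    IsTopTwoSubgroup (e x) (P.map e.toMonoidHom) := by
  refine ⟨h.isPGroup.map _, ⟨x, h.mem, rfl⟩, fun Q hQ hx => ?_⟩
  have hle := h.le (Q.comap e.toMonoidHom) (hQ.comap_of_injective _ e.injective) hx
  intro q hq
  refine ⟨e.symm q, hle ?_, e.apply_symm_apply q⟩
  simpa using hq

theorem conj (h : IsTopTwoSubgroup x P) (g : G) :
    ∃ P' : Subgroup G, IsTopTwoSubgroup (g * x * g⁻¹) P' :=
  ⟨_, h.map (MulAut.conj g)⟩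

theorem mem_of_conj_mem (h : IsTopTwoSubgroup x P) {k : ℕ} (hy : y ^ 2 ^ k = 1)
    (hyx : y * x * y⁻¹ ∈ P) (hyy : Commute (y ^ 2) x) : y ∈ P := by
  set Q : Subgroup G := Subgroup.closure {x, y * x * y⁻¹} with hQ
  have hQP : Q ≤ P := by
    rw [hQ, Subgroup.closure_le]
    rintro g (rfl | rfl)
    exacts [h.mem, hyx]
  have hy2 : y ^ 2 * x * (y ^ 2)⁻¹ = x := by rw [hyy.eq, mul_inv_cancel_right]
  have hmap : Q.map (MulAut.conj y).toMonoidHom = Q := by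
    rw [hQ, MonoidHom.map_closure, Set.image_pair]
    have h1 : (MulAut.conj y).toMonoidHom x = y * x * y⁻¹ := rfl
    have h2 : (MulAut.conj y).toMonoidHom (y * x * y⁻¹) = x := by
      change y * (y * x * y⁻¹) * y⁻¹ = x
      rw [pow_two] at hy2
      simpa [mul_assoc] using hy2
    rw [h1, h2, Set.pair_comm]
  have hyN : Subgroup.zpowers y ≤ Subgroup.normalizer (Q : Set G) := by
    rw [Subgroup.zpowers_le, Subgroup.mem_normalizer_iff]
    intro g
    constructor
    · intro hg
      rw [← hmap]
      exact ⟨g, hg, rfl⟩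
    · intro hg
      rw [← hmap] at hg
      obtain ⟨g', hg', he⟩ := hg
      have : g' = g := (MulAut.conj y).injective he
      rwa [← this]
  have hp := IsPGroup.to_sup_of_normal_right' (isPGroup_zpowers hy)
    (h.isPGroup.to_le hQP) hyN
  have hxQ : x ∈ Q := Subgroup.subset_closure (by simp)
  exact h.le _ hp ((le_sup_right : Q ≤ _) hxQ) ((le_sup_left : Subgroup.zpowers y ≤ _)
    (Subgroup.mem_zpowers y))

theorem mem_of_commute (h : IsTopTwoSubgroup x P) {k : ℕ} (hy : y ^ 2 ^ k = 1)
    (hyx : Commute y x) : y ∈ P := by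
  refine h.mem_of_conj_mem hy ?_ (hyx.pow_left 2)
  rw [hyx.eq, mul_inv_cancel_right]
  exact h.mem

end IsTopTwoSubgroup

/-- A finite `2`-group `Q` lies in `S` if it contains no element outside of `S` that
normalizes `Q ⊓ S`. -/
theorem IsPGroup.le_of_forall_conj_mem [Finite G] {Q S : Subgroup G} (hQ : IsPGroup 2 Q)
    (h : ∀ y ∈ Q, (∀ r ∈ Q, r ∈ S → y * r * y⁻¹ ∈ S) → y ∈ S) : Q ≤ S := by
  have : Fact (Nat.Prime 2) := ⟨Nat.prime_two⟩
  have hnil : Group.IsNilpotent Q := hQ.isNilpotent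
  have hnc := normalizerCondition_iff_only_full_group_self_normalizing.mp
    (Group.normalizerCondition_of_isNilpotent (G := Q)) (S.subgroupOf Q) ?_
  · exact Subgroup.subgroupOf_eq_top.mp hnc
  refine le_antisymm (fun y hy => ?_) Subgroup.le_normalizer
  rw [Subgroup.mem_subgroupOf]
  refine h y y.2 fun r hrQ hrS => ?_
  exact (Subgroup.mem_normalizer_iff.mp hy ⟨r, hrQ⟩).mp hrS

theorem isTopTwoSubgroup_of_forall_conj_mem [Finite G] {x : G} {P : Subgroup G}
    (hP : IsPGroup 2 P) (hx : x ∈ P)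
    (h : ∀ (y : G) (k : ℕ), y ^ 2 ^ k = 1 → y * x * y⁻¹ ∈ P → y ∈ P) : IsTopTwoSubgroup x P := by
  refine ⟨hP, hx, fun Q hQ hxQ => hQ.le_of_forall_conj_mem fun y hy hyr => ?_⟩
  obtain ⟨k, hk⟩ := hQ.exists_pow_eq_one hy
  exact h y k hk (hyr x hxQ hx)

end Picky

section Arithmetic

theorem eq_one_of_pow_eq_two_pow_add {p k n : ℕ} {ε : ℤ} (hp : 3 ≤ p) (hk : Odd k)
    (hε : ε = 1 ∨ ε = -1) (h : (p : ℤ) ^ k = 2 ^ n + ε) : k = 1 := by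
  have hε2 : ε ^ 2 = 1 := by rcases hε with rfl | rfl <;> norm_num
  obtain ⟨j, rfl⟩ := hk
  have hεk : ε ^ (2 * j + 1) = ε := by rw [pow_succ, pow_mul, hε2, one_pow, one_mul]
  have hdvd : (p : ℤ) - ε ∣ 2 ^ n := by
    have := sub_dvd_pow_sub_pow (p : ℤ) ε (2 * j + 1)
    rwa [hεk, h, add_sub_cancel_right] at this
  obtain ⟨a, ha⟩ : ∃ a : ℕ, (p : ℤ) - ε = 2 ^ a := by
    lift (p : ℤ) - ε to ℕ using (by omega) with d
    obtain ⟨a, -, ha⟩ := (Nat.dvd_prime_pow Nat.prime_two).mp (by exact_mod_cast hdvd : d ∣ 2 ^ n)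
    exact ⟨a, by exact_mod_cast ha⟩
  have ha1 : 1 ≤ a := by
    by_contra! h0
    obtain rfl : a = 0 := by omega
    omega
  have hp2 : (p : ℤ) ^ 2 ≡ 1 [ZMOD 2 ^ (a + 1)] := by
    refine (Int.modEq_iff_dvd.mpr ⟨-2 ^ (a - 1) - ε, ?_⟩)
    have h1 : (2 : ℤ) ^ a = 2 * 2 ^ (a - 1) := by rw [← pow_succ', Nat.sub_add_cancel ha1]
    have h3 : (p : ℤ) = 2 ^ a + ε := by linarith
    rw [h3, pow_succ]
    linear_combination -hε2 - 2 ^ a * h1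
  have hpk : (p : ℤ) ^ (2 * j + 1) ≡ p [ZMOD 2 ^ (a + 1)] := by
    have := (hp2.pow j).mul_right (p : ℤ)
    rwa [one_pow, one_mul, ← pow_mul, ← pow_succ] at this
  have hn : n ≤ a := by
    by_contra! hlt
    have h1 : (2 : ℤ) ^ (a + 1) ∣ 2 ^ n := pow_dvd_pow 2 hlt
    have h2 : (2 : ℤ) ^ (a + 1) ∣ 2 ^ a := by
      have h3 := hpk.dvd
      rw [h] at h3
      have h4 := dvd_add h3 h1
      rwa [show (p : ℤ) - (2 ^ n + ε) + 2 ^ n = 2 ^ a by rw [← ha]; ring] at h4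
    have h5 := Int.le_of_dvd (by positivity) h2
    rw [pow_succ] at h5
    have : (0 : ℤ) < 2 ^ a := by positivity
    omega
  have hle : (2 : ℤ) ^ n ≤ 2 ^ a := pow_le_pow_right₀ (by norm_num) hn
  have hle' : (p : ℤ) ^ (2 * j + 1) ≤ (p : ℤ) ^ 1 := by rw [h, pow_one]; omega
  have := (pow_le_pow_iff_right₀ (show (1 : ℤ) < p by exact_mod_cast (by omega : 1 < p))).mp hle'
  omega

theorem eq_three_of_sq_eq_two_pow_add_one {r n : ℕ} (hr : 2 ≤ r) (h : r ^ 2 = 2 ^ n + 1) :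
    r = 3 := by
  obtain ⟨s, rfl⟩ : ∃ s, r = s + 1 := ⟨r - 1, by omega⟩
  have h' : s * (s + 2) = 2 ^ n := by linarith
  obtain ⟨a, -, ha⟩ := (Nat.dvd_prime_pow Nat.prime_two).mp (Dvd.intro _ h')
  obtain ⟨b, -, hb⟩ := (Nat.dvd_prime_pow Nat.prime_two).mp (Dvd.intro_left _ h')
  have hab : a < b := by
    rw [← Nat.pow_lt_pow_iff_right one_lt_two]
    omega
  match a, ha with
  | 0, ha =>
    obtain ⟨c, rfl⟩ : ∃ c, b = c + 1 := ⟨b - 1, by omega⟩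
    rw [pow_succ] at hb
    omega
  | 1, ha => omega
  | a + 2, ha =>
    obtain ⟨c, rfl⟩ : ∃ c, b = c + 2 := ⟨b - 2, by omega⟩
    rw [pow_add] at ha hb
    omega

theorem IsPrimePow.prime_of_eq_two_pow {q n : ℕ} (hq : IsPrimePow q) (hodd : Odd q) (h9 : q ≠ 9)
    (h : q = 2 ^ n + 1 ∨ q + 1 = 2 ^ n) : q.Prime := by
  obtain ⟨p, k, hp, hk, rfl⟩ := (isPrimePow_nat_iff q).mp hq
  have hpodd : Odd p := (Nat.odd_pow_iff hk.ne').mp hodd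
  have hp3 : 3 ≤ p := by
    obtain ⟨t, rfl⟩ := hpodd
    have := hp.two_le
    omega
  rcases Nat.even_or_odd k with hke | hko
  · exfalso
    obtain ⟨j, rfl⟩ := hke
    have hj : j ≠ 0 := by omega
    have hr2 : p ^ (j + j) = (p ^ j) ^ 2 := by rw [← pow_mul, mul_two]
    have hr : 3 ≤ p ^ j := hp3.trans (Nat.le_self_pow hj p)
    rw [hr2] at h h9
    rcases h with h | h
    · exact h9 (by rw [eq_three_of_sq_eq_two_pow_add_one (by omega) h]; rfl)
    · obtain ⟨t, ht⟩ : Odd (p ^ j) := hpodd.pow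
      rw [ht] at h hr
      match n with
      | 0 => nlinarith
      | 1 => nlinarith
      | n + 2 =>
        rw [pow_add 2 n] at h
        have : (2 * t + 1) ^ 2 = 4 * (t ^ 2 + t) + 1 := by ring
        omega
  · have : k = 1 := by
      rcases h with h | h
      · exact eq_one_of_pow_eq_two_pow_add (n := n) hp3 hko (Or.inl rfl) (by exact_mod_cast h)
      · refine eq_one_of_pow_eq_two_pow_add (n := n) hp3 hko (Or.inr rfl) ?_
        rw [← sub_eq_add_neg, eq_sub_iff_add_eq]
        exact_mod_cast h
    rwa [this, pow_one]

end Arithmetic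

namespace SpFour

open Matrix

/-- The `2 × 2` matrices over `F`. -/
abbrev Mat (F : Type*) := Matrix (Fin 2) (Fin 2) F

variable {F : Type*} [Field F]

/-- The adjugate as an involution on `2 × 2` matrices. -/
@[reducible] def adjugateStarRing : StarRing (Mat F) where
  star := Matrix.adjugate
  star_involutive A := by simpa using Matrix.adjugate_adjugate' A
  star_mul A B := Matrix.adjugate_mul_distrib A B
  star_add A B := by
    ext i j
    fin_cases i <;> fin_cases j <;> simp [Matrix.adjugate_fin_two] <;> ring

attribute [local instance] adjugateStarRing

/-- `SL₂(F)`, as the unitary group of the adjugate involution. -/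
abbrev SLTwo (F : Type*) [Field F] := unitary (Mat F)

/-- `Sp₄(F)`, as the `2 × 2` unitary group over `Mat F`. -/
abbrev SpU (F : Type*) [Field F] := unitary (Matrix (Fin 2) (Fin 2) (Mat F))

theorem star_eq_adjugate (A : Mat F) : star A = A.adjugate := rfl

@[simp] theorem star_of (a b c d : F) : star !![a, b; c, d] = !![d, -b; -c, a] :=
  Matrix.adjugate_fin_two_of a b c d

@[simp] theorem star_block (A B C D : Mat F) :
    star !![A, B; C, D] = !![star A, star C; star B, star D] := by
  ext i j : 2
  fin_cases i <;> fin_cases j <;> rfl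

theorem one_block : (1 : Matrix (Fin 2) (Fin 2) (Mat F)) = !![1, 0; 0, 1] :=
  Matrix.one_fin_two

theorem mul_star_eq (A : Mat F) : A * star A = A.det • (1 : Mat F) := Matrix.mul_adjugate A

theorem star_mul_eq (A : Mat F) : star A * A = A.det • (1 : Mat F) := Matrix.adjugate_mul A

theorem add_star_eq (A : Mat F) : A + star A = A.trace • (1 : Mat F) := by
  ext i j
  fin_cases i <;> fin_cases j <;>
    simp [star_eq_adjugate, Matrix.adjugate_fin_two, Matrix.trace_fin_two, add_comm]

theorem mem_SLTwo_iff {A : Mat F} : A ∈ unitary (Mat F) ↔ A.det = 1 := by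
  rw [Unitary.mem_iff, star_mul_eq, mul_star_eq, and_self]
  constructor
  · intro h
    simpa using congrFun (congrFun h 0) 0
  · intro h
    rw [h, one_smul]

theorem det_coe (a : SLTwo F) : (a : Mat F).det = 1 := mem_SLTwo_iff.mp a.2

theorem mem_SpU_iff {x : Matrix (Fin 2) (Fin 2) (Mat F)} :
    x ∈ unitary (Matrix (Fin 2) (Fin 2) (Mat F)) ↔ x * star x = 1 := by
  rw [Unitary.mem_iff]
  exact ⟨And.right, fun h => ⟨mul_eq_one_comm.mp h, h⟩⟩

theorem mem_SpU_of {A B C D : Mat F} (h1 : A * star A + B * star B = 1)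
    (h2 : A * star C + B * star D = 0) (h3 : C * star C + D * star D = 1) :
    !![A, B; C, D] ∈ unitary (Matrix (Fin 2) (Fin 2) (Mat F)) := by
  have h2' : C * star A + D * star B = 0 := by simpa using congrArg star h2
  rw [mem_SpU_iff, star_block, Matrix.mul_fin_two, h1, h2, h3, h2', one_block]

/-- The element `diag(a, b)` of `SL₂ × SL₂ ≤ Sp₄`. -/
def diagU (a b : SLTwo F) : SpU F :=
  ⟨!![(a : Mat F), 0; 0, (b : Mat F)], mem_SpU_of (by simp) (by simp) (by simp)⟩

/-- The antidiagonal element with entries `a`, `b` of `Sp₄`. -/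
def antiU (a b : SLTwo F) : SpU F :=
  ⟨!![0, (a : Mat F); (b : Mat F), 0], mem_SpU_of (by simp) (by simp) (by simp)⟩

@[simp] theorem coe_diagU (a b : SLTwo F) :
    (diagU a b : Matrix (Fin 2) (Fin 2) (Mat F)) = !![(a : Mat F), 0; 0, (b : Mat F)] := rfl

@[simp] theorem coe_antiU (a b : SLTwo F) :
    (antiU a b : Matrix (Fin 2) (Fin 2) (Mat F)) = !![0, (a : Mat F); (b : Mat F), 0] := rfl

@[simp] theorem diagU_mul_diagU (a b c d : SLTwo F) :
    diagU a b * diagU c d = diagU (a * c) (b * d) := by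
  refine Subtype.ext ?_
  simp only [Submonoid.coe_mul, coe_diagU, Matrix.mul_fin_two, mul_zero,
    zero_mul, add_zero, zero_add]

@[simp] theorem diagU_mul_antiU (a b c d : SLTwo F) :
    diagU a b * antiU c d = antiU (a * c) (b * d) := by
  refine Subtype.ext ?_
  simp only [Submonoid.coe_mul, coe_diagU, coe_antiU, Matrix.mul_fin_two, mul_zero,
    zero_mul, add_zero, zero_add]

@[simp] theorem antiU_mul_diagU (a b c d : SLTwo F) :
    antiU a b * diagU c d = antiU (a * d) (b * c) := by
  refine Subtype.ext ?_
  simp only [Submonoid.coe_mul, coe_diagU, coe_antiU, Matrix.mul_fin_two, mul_zero,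
    zero_mul, add_zero, zero_add]

@[simp] theorem antiU_mul_antiU (a b c d : SLTwo F) :
    antiU a b * antiU c d = diagU (a * d) (b * c) := by
  refine Subtype.ext ?_
  simp only [Submonoid.coe_mul, coe_diagU, coe_antiU, Matrix.mul_fin_two, mul_zero,
    zero_mul, add_zero, zero_add]

theorem diagU_one_one : diagU (1 : SLTwo F) 1 = 1 := by
  refine Subtype.ext ?_
  simp only [coe_diagU, OneMemClass.coe_one, one_block]

@[simp] theorem diagU_eq_one {a b : SLTwo F} : diagU a b = 1 ↔ a = 1 ∧ b = 1 := by
  refine ⟨fun h => ?_, fun ⟨h1, h2⟩ => by rw [h1, h2, diagU_one_one]⟩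
  have h' := congrArg Subtype.val h
  exact ⟨Subtype.ext (congrFun (congrFun h' 0) 0), Subtype.ext (congrFun (congrFun h' 1) 1)⟩

theorem diagU_inj {a b c d : SLTwo F} : diagU a b = diagU c d ↔ a = c ∧ b = d := by
  refine ⟨fun h => ?_, fun ⟨h1, h2⟩ => by rw [h1, h2]⟩
  have h' := congrArg Subtype.val h
  exact ⟨Subtype.ext (congrFun (congrFun h' 0) 0), Subtype.ext (congrFun (congrFun h' 1) 1)⟩

@[simp] theorem diagU_inv (a b : SLTwo F) : (diagU a b)⁻¹ = diagU a⁻¹ b⁻¹ := by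
  rw [inv_eq_iff_mul_eq_one]; simp

@[simp] theorem antiU_inv (a b : SLTwo F) : (antiU a b)⁻¹ = antiU b⁻¹ a⁻¹ := by
  rw [inv_eq_iff_mul_eq_one]; simp

@[simp] theorem diagU_pow (a b : SLTwo F) (n : ℕ) : diagU a b ^ n = diagU (a ^ n) (b ^ n) := by
  induction n with
  | zero => simp [diagU_one_one]
  | succ n ih => rw [pow_succ, ih, diagU_mul_diagU, pow_succ, pow_succ]

section Model

/-- Reordering the symplectic basis `e₁, e₂, f₁, f₂` as two hyperbolic pairs `(eᵢ, fᵢ)`. -/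
def blockRingEquiv (F : Type*) [Field F] :
    Matrix (Fin 2 ⊕ Fin 2) (Fin 2 ⊕ Fin 2) F ≃+* Matrix (Fin 2) (Fin 2) (Mat F) where
  toFun A := Matrix.of fun i j => !![A (.inl i) (.inl j), A (.inl i) (.inr j);
    A (.inr i) (.inl j), A (.inr i) (.inr j)]
  invFun x := Matrix.fromBlocks (Matrix.of fun i j => x i j 0 0) (Matrix.of fun i j => x i j 0 1)
    (Matrix.of fun i j => x i j 1 0) (Matrix.of fun i j => x i j 1 1)
  left_inv A := by
    ext (i | i) (j | j) <;> simp
  right_inv x := by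
    ext i j k l
    fin_cases k <;> fin_cases l <;> simp
  map_mul' A B := by
    ext i j k l
    fin_cases k <;> fin_cases l <;>
      simp [Matrix.mul_apply, Fintype.sum_sum_type, Fin.sum_univ_two] <;> ring
  map_add' A B := by
    ext i j k l
    fin_cases k <;> fin_cases l <;> simp

theorem blockRingEquiv_neg_J_transpose_J (A : Matrix (Fin 2 ⊕ Fin 2) (Fin 2 ⊕ Fin 2) F) :
    blockRingEquiv F (-(J (Fin 2) F * Aᵀ * J (Fin 2) F)) = star (blockRingEquiv F A) := by
  rw [← Matrix.fromBlocks_toBlocks A, J, Matrix.fromBlocks_transpose, Matrix.fromBlocks_multiply,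
    Matrix.fromBlocks_multiply]
  ext i j : 1
  rw [Matrix.star_apply, star_eq_adjugate, Matrix.adjugate_fin_two]
  ext k l
  fin_cases k <;> fin_cases l <;> simp [blockRingEquiv]

theorem blockRingEquiv_mem_iff (A : Matrix (Fin 2 ⊕ Fin 2) (Fin 2 ⊕ Fin 2) F) :
    blockRingEquiv F A ∈ unitary (Matrix (Fin 2) (Fin 2) (Mat F)) ↔
      A ∈ symplecticGroup (Fin 2) F := by
  rw [mem_SpU_iff, ← blockRingEquiv_neg_J_transpose_J, ← map_mul,
    EmbeddingLike.map_eq_one_iff, SymplecticGroup.mem_iff, mul_neg, ← mul_assoc, ← mul_assoc]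
  have hJ := J_squared (Fin 2) F
  constructor
  · intro h
    have h2 := congrArg (· * J (Fin 2) F) h
    simp only [neg_mul, mul_assoc, hJ, one_mul, mul_neg, mul_one, neg_neg] at h2
    rw [mul_assoc, h2]
  · intro h
    rw [h, hJ, neg_neg]

/-- The two models of `Sp₄(F)` are isomorphic. -/
noncomputable def symplecticEquiv (F : Type*) [Field F] :
    symplecticGroup (Fin 2) F ≃* SpU F where
  toFun A := ⟨blockRingEquiv F A, (blockRingEquiv_mem_iff _).mpr A.2⟩
  invFun x := ⟨(blockRingEquiv F).symm x, (blockRingEquiv_mem_iff _).mp (by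
    rw [RingEquiv.apply_symm_apply]; exact x.2)⟩
  left_inv A := by simp
  right_inv x := by simp
  map_mul' A B := by
    refine Subtype.ext ?_
    simp

end Model

section Rotation

/-- A nondegenerate binary quadratic form over a finite field of odd order is universal. -/
theorem exists_binary_quadratic_eq [Fintype F] (hF : Odd (Fintype.card F)) (h2 : (2 : F) ≠ 0)
    {A B C : F} (hd : B ^ 2 - 4 * A * C ≠ 0) (c : F) :
    ∃ u v : F, A * u ^ 2 + B * (u * v) + C * v ^ 2 = c := by
  by_cases hA : A = 0
  · subst hA
    have hB : B ≠ 0 := by rintro rfl; simp at hd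
    exact ⟨(c - C) / B, 1, by field_simp; ring⟩
  have hD : 4 * A * C - B ^ 2 ≠ 0 := fun h => hd (by linear_combination -h)
  obtain ⟨x, y, hxy⟩ := FiniteField.exists_root_sum_quadratic
    (f := Polynomial.X ^ 2) (g := Polynomial.C (4 * A * C - B ^ 2) * Polynomial.X ^ 2 -
      Polynomial.C (4 * A * c)) (by compute_degree!) (by compute_degree!)
    (Nat.odd_iff.mp hF)
  simp only [Polynomial.eval_sub, Polynomial.eval_mul, Polynomial.eval_pow, Polynomial.eval_X,
    Polynomial.eval_C] at hxy
  refine ⟨(x - B * y) / (2 * A), y, ?_⟩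
  field_simp
  linear_combination hxy

/-- An element of `2`-power order satisfying `z² = θ z - 1` with `θ ≠ ±2` generates a square root
of `-1`. -/
theorem isSquare_four_sub_sq {R : Type*} [Ring R] [Nontrivial R] [Algebra F R] (m : ℕ) :
    ∀ (z : R) (θ : F), z * z = θ • z - 1 → z ^ 2 ^ m = 1 → θ ^ 2 ≠ 4 → IsSquare (4 - θ ^ 2) := by
  induction m with
  | zero =>
    intro z θ hz h1 h4
    rw [pow_zero, pow_one] at h1
    subst h1
    have h : (2 - θ) • (1 : R) = 0 := by
      rw [sub_smul, two_smul]
      nth_rewrite 1 [← mul_one (1 : R)]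
      rw [hz]
      abel
    rcases smul_eq_zero.mp h with h | h
    · exact absurd (by linear_combination (-θ - 2) * h) h4
    · exact absurd h one_ne_zero
  | succ m ih =>
    intro z θ hz h1 h4
    have hz' : z * z * (z * z) = (θ ^ 2 - 2) • (z * z) - 1 := by
      have h : θ • z = z * z + 1 := by rw [hz]; abel
      have h' : (z * z + 1) * (z * z + 1) = (θ ^ 2) • (z * z) := by
        rw [← h, smul_mul_smul_comm, pow_two]
      rw [sub_smul, ← h', two_smul]
      noncomm_ring
    have h1' : (z * z) ^ 2 ^ m = 1 := by rw [← pow_two, ← pow_mul, ← pow_succ', h1]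
    by_cases hθ : θ = 0
    · exact ⟨2, by rw [hθ]; norm_num⟩
    · obtain ⟨r, hr⟩ := ih _ _ hz' h1' fun h => by
        have : θ ^ 2 * (θ ^ 2 - 4) = 0 := by linear_combination h
        rcases mul_eq_zero.mp this with h | h
        · exact hθ (by simpa using h)
        · exact h4 (by linear_combination h)
      exact ⟨r / θ, by field_simp; linear_combination hr⟩

theorem mul_self_eq (a : SLTwo F) : (a : Mat F) * a = (a : Mat F).trace • (a : Mat F) - 1 := by
  have h := congrArg ((a : Mat F) * ·) (add_star_eq (a : Mat F))
  simp only [mul_add, mul_star_eq, det_coe, one_smul, mul_smul_comm, mul_one] at h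
  exact eq_sub_of_add_eq h

theorem coe_inv_eq (a : SLTwo F) : ((a⁻¹ : SLTwo F) : Mat F) = (a : Mat F).trace • 1 - a :=
  eq_sub_of_add_eq (by rw [add_comm]; exact add_star_eq (a : Mat F))

theorem trace_conj (s a : SLTwo F) :
    ((s * a * s⁻¹ : SLTwo F) : Mat F).trace = (a : Mat F).trace := by
  have : ((s⁻¹ * s : SLTwo F) : Mat F) = 1 := by simp
  rw [Submonoid.coe_mul, Submonoid.coe_mul, Matrix.trace_mul_comm, ← mul_assoc,
    ← Submonoid.coe_mul, this, one_mul]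

theorem one_add_pow_of_mul_self_eq_zero {R : Type*} [Ring R] {N : R} (hN : N * N = 0) (n : ℕ) :
    (1 + N) ^ n = 1 + n • N := by
  induction n with
  | zero => simp
  | succ n ih => rw [pow_succ, ih, add_mul, mul_add, smul_mul_assoc, mul_add, hN, succ_nsmul]; simp
                 abel

theorem eq_one_of_trace_eq_two (h2 : (2 : F) ≠ 0) {a : SLTwo F} {k : ℕ} (ha : a ^ 2 ^ k = 1)
    (ht : (a : Mat F).trace = 2) : a = 1 := by
  have hN : ((a : Mat F) - 1) * ((a : Mat F) - 1) = 0 := by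
    have := mul_self_eq a
    rw [ht, two_smul] at this
    rw [mul_sub, sub_mul, this]
    simp only [one_mul, mul_one]
    abel
  have h := one_add_pow_of_mul_self_eq_zero hN (2 ^ k)
  rw [add_sub_cancel, ← SubmonoidClass.coe_pow, ha, OneMemClass.coe_one, left_eq_add,
    ← Nat.cast_smul_eq_nsmul F, smul_eq_zero] at h
  rcases h with h | h
  · exact absurd h (by push_cast; exact pow_ne_zero _ h2)
  · exact Subtype.ext (sub_eq_zero.mp h)

theorem eq_one_or_neg_one_of_trace_sq (h2 : (2 : F) ≠ 0) {a : SLTwo F} {k : ℕ}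
    (ha : a ^ 2 ^ k = 1) (ht : (a : Mat F).trace ^ 2 = 4) : a = 1 ∨ a = -1 := by
  have h : ((a : Mat F).trace - 2) * ((a : Mat F).trace + 2) = 0 := by linear_combination ht
  rcases mul_eq_zero.mp h with h | h
  · exact Or.inl (eq_one_of_trace_eq_two h2 ha (sub_eq_zero.mp h))
  · refine Or.inr ?_
    have h1 : (-a) ^ 2 ^ (k + 1) = 1 := by
      rw [pow_succ', pow_mul, neg_sq, ← pow_mul, ← pow_succ', pow_succ, pow_mul, ha, one_pow]
    have := eq_one_of_trace_eq_two h2 h1 (by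
      rw [Unitary.coe_neg, Matrix.trace_neg]; linear_combination -h)
    rw [← this, neg_neg]

/-- The rotation matrix with first column `(α, β)`. -/
def rot (α β : F) : Mat F := !![α, -β; β, α]

@[simp] theorem rot_mul_rot (α β γ δ : F) :
    rot α β * rot γ δ = rot (α * γ - β * δ) (α * δ + β * γ) := by
  simp only [rot, Matrix.mul_fin_two]
  ext i j
  fin_cases i <;> fin_cases j <;> simp <;> ring

@[simp] theorem rot_add_rot (α β γ δ : F) : rot α β + rot γ δ = rot (α + γ) (β + δ) := by
  ext i j
  fin_cases i <;> fin_cases j <;> simp [rot, add_comm]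

@[simp] theorem neg_rot (α β : F) : -rot α β = rot (-α) (-β) := by
  ext i j
  fin_cases i <;> fin_cases j <;> simp [rot]

@[simp] theorem smul_rot (c α β : F) : c • rot α β = rot (c * α) (c * β) := by
  ext i j
  fin_cases i <;> fin_cases j <;> simp [rot]

@[simp] theorem star_rot (α β : F) : star (rot α β) = rot α (-β) := by
  simp [rot]

theorem rot_one_zero : rot (1 : F) 0 = 1 := by
  simp [rot, Matrix.one_fin_two]

theorem rot_zero_zero : rot (0 : F) 0 = 0 := by
  ext i j
  fin_cases i <;> fin_cases j <;> simp [rot]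

@[simp] theorem trace_rot (α β : F) : (rot α β).trace = 2 * α := by
  simp [rot, Matrix.trace_fin_two, two_mul]

@[simp] theorem det_rot (α β : F) : (rot α β).det = α ^ 2 + β ^ 2 := by
  simp [rot, Matrix.det_fin_two]; ring

theorem rot_inj {α β γ δ : F} : rot α β = rot γ δ ↔ α = γ ∧ β = δ := by
  refine ⟨fun h => ⟨by simpa [rot] using congrFun (congrFun h 0) 0,
    by simpa [rot] using congrFun (congrFun h 1) 0⟩, fun ⟨h1, h2⟩ => by rw [h1, h2]⟩

/-- The rotation matrices as elements of `SL₂(F)`. -/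
def rotS (α β : F) (h : α ^ 2 + β ^ 2 = 1) : SLTwo F :=
  ⟨rot α β, mem_SLTwo_iff.mpr (by rw [det_rot, h])⟩

@[simp] theorem coe_rotS (α β : F) (h : α ^ 2 + β ^ 2 = 1) :
    ((rotS α β h : SLTwo F) : Mat F) = rot α β := rfl

/-- A matrix in `SL₂(F)` whose eigenvalue algebra contains a square root of `-1` is conjugate
to a rotation. -/
theorem exists_conj_eq_rot [Fintype F] (hF : Odd (Fintype.card F)) (h2 : (2 : F) ≠ 0)
    (a : SLTwo F) (hsq : IsSquare (4 - (a : Mat F).trace ^ 2)) (ht : (a : Mat F).trace ^ 2 ≠ 4) :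
    ∃ (s : SLTwo F) (α β : F) (h : α ^ 2 + β ^ 2 = 1), β ≠ 0 ∧ s * a * s⁻¹ = rotS α β h := by
  obtain ⟨δ, hδ⟩ := hsq
  have hdet := det_coe a
  obtain ⟨p, q, r, t, hA⟩ : ∃ p q r t, (a : Mat F) = !![p, q; r, t] :=
    ⟨_, _, _, _, Matrix.eta_fin_two _⟩
  simp only [hA, Matrix.trace_fin_two_of, Matrix.det_fin_two_of] at hδ hdet ht
  have hδ0 : δ ≠ 0 := by
    rintro rfl
    exact ht (by linear_combination -hδ)
  obtain ⟨u, v, huv⟩ := exists_binary_quadratic_eq hF h2 (A := 2 * r / δ)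
    (B := 2 * (t - p) / δ) (C := -(2 * q) / δ) (by
      intro h
      have : δ ^ 2 * 4 = 0 := by
        field_simp at h
        linear_combination -h - 4 * hδ - 16 * hdet
      rcases mul_eq_zero.mp this with h | h
      · exact hδ0 (by simpa using h)
      · exact h2 (by have : (2 : F) * 2 = 0 := by linear_combination h
                     simpa using this)) 1
  let g : Mat F := !![u, ((p - t) * u + 2 * q * v) / δ; v, (2 * r * u + (t - p) * v) / δ]
  have hg : g.det = 1 := by
    rw [← huv]
    simp only [g, Matrix.det_fin_two_of]
    field_simp
    ring
  let s : SLTwo F := ⟨g, mem_SLTwo_iff.mpr hg⟩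
  have hαβ : ((p + t) / 2) ^ 2 + (δ / 2) ^ 2 = 1 := by
    field_simp
    linear_combination -hδ
  refine ⟨s⁻¹, (p + t) / 2, δ / 2, hαβ, div_ne_zero hδ0 h2, ?_⟩
  rw [inv_inv, mul_assoc, inv_mul_eq_iff_eq_mul]
  refine Subtype.ext ?_
  simp only [Submonoid.coe_mul, coe_rotS, hA, s, g, rot, Matrix.mul_fin_two]
  congr 1
  ext i j
  fin_cases i <;> fin_cases j <;> simp <;> field_simp
  · ring
  · linear_combination (-u) * hδ - 4 * u * hdet
  · ring
  · linear_combination (-v) * hδ - 4 * v * hdet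

end Rotation

section Obstructions

@[simp] theorem coe_neg_one : ((-1 : SLTwo F) : Mat F) = -1 := rfl

theorem sq_eq_neg_one_of_trace_eq_zero {a : SLTwo F} (h : (a : Mat F).trace = 0) :
    a ^ 2 = -1 := by
  refine Subtype.ext ?_
  rw [pow_two, Submonoid.coe_mul, mul_self_eq, h, zero_smul, zero_sub]
  rfl

theorem pow_four_eq_one_of_sq_eq_neg_one {R : Type*} [Monoid R] [HasDistribNeg R] {a : R}
    (h : a ^ 2 = -1) : a ^ 2 ^ 2 = 1 := by
  rw [show 2 ^ 2 = 2 * 2 by rfl, pow_mul, h, neg_one_sq]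

/-- The subgroup generated by the trace zero elements of `SL₂(F)` is no `2`-group
unless `|F| ≤ 3`. -/
theorem not_isPGroup_of_trace_zero_mem [Fintype F] (hF : 4 ≤ Fintype.card F) (h2 : (2 : F) ≠ 0)
    {N : Subgroup (SLTwo F)} (hN : IsPGroup 2 N)
    (h0 : ∀ a : SLTwo F, (a : Mat F).trace = 0 → a ∈ N) : False := by
  classical
  obtain ⟨t, ht⟩ : ∃ t : F, t ∉ ({0, 1, -1} : Finset F) := by
    by_contra! h
    have h3 := Finset.card_le_three (a := (0 : F)) (b := 1) (c := -1)
    rw [Finset.eq_univ_iff_forall.mpr h, Finset.card_univ] at h3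
    omega
  simp only [Finset.mem_insert, Finset.mem_singleton, not_or] at ht
  obtain ⟨ht0, ht1, ht2⟩ := ht
  have key (A : Mat F) (hd : A.det = 1) (htr : A.trace = 0) :
      ∃ a ∈ N, ((a : SLTwo F) : Mat F) = A := ⟨⟨A, mem_SLTwo_iff.mpr hd⟩, h0 _ htr, rfl⟩
  obtain ⟨a, ha, hA⟩ := key !![-1, 2; -1, 1] (by simp [Matrix.det_fin_two]; norm_num)
    (by simp [Matrix.trace_fin_two])
  obtain ⟨b, hb, hB⟩ := key !![-t⁻¹, t + t⁻¹; -t⁻¹, t⁻¹]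
    (by simp [Matrix.det_fin_two]; field_simp; ring) (by simp [Matrix.trace_fin_two])
  obtain ⟨c, hc, hC⟩ := key !![0, -t; t⁻¹, 0] (by simp [Matrix.det_fin_two, ht0])
    (by simp [Matrix.trace_fin_two])
  obtain ⟨d, hd, hD⟩ := key !![0, -1; 1, 0] (by simp [Matrix.det_fin_two])
    (by simp [Matrix.trace_fin_two])
  obtain ⟨k, hk⟩ := hN.exists_pow_eq_one (mul_mem (mul_mem (mul_mem ha hb) hc) hd)
  have hm : ((a * b * c * d : SLTwo F) : Mat F) = 1 + !![0, 1 - t⁻¹ ^ 2; 0, 0] := by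
    simp only [Submonoid.coe_mul, hA, hB, hC, hD, Matrix.mul_fin_two, Matrix.one_fin_two]
    ext i j
    fin_cases i <;> fin_cases j <;> simp <;> field_simp <;> ring
  have h1 : ((1 : Mat F) + !![0, 1 - t⁻¹ ^ 2; 0, 0]) ^ 2 ^ k = 1 := by
    rw [← hm, ← SubmonoidClass.coe_pow, hk, OneMemClass.coe_one]
  rw [one_add_pow_of_mul_self_eq_zero
    (by ext i j; fin_cases i <;> fin_cases j <;> simp), add_eq_left, ← Nat.cast_smul_eq_nsmul F,
    smul_eq_zero] at h1
  rcases h1 with h1 | h1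
  · exact pow_ne_zero _ h2 (by simpa using h1)
  · have h1 : 1 - t⁻¹ ^ 2 = 0 := by simpa using congrFun (congrFun h1 0) 1
    field_simp at h1
    rcases mul_eq_zero.mp (by linear_combination h1 : (t - 1) * (t + 1) = 0) with h | h
    · exact ht1 (sub_eq_zero.mp h)
    · exact ht2 (eq_neg_of_add_eq_zero_left h)

theorem false_of_isTop_of_commute [Fintype F] (hF : 4 ≤ Fintype.card F)
    (h2 : (2 : F) ≠ 0) {x : SpU F} {P : Subgroup (SpU F)} (h : IsTopTwoSubgroup x P)
    (φ : SLTwo F →* SpU F) (hφ : Function.Injective φ) (hc : ∀ s, Commute (φ s) x) : False := by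
  refine not_isPGroup_of_trace_zero_mem hF h2 (h.isPGroup.comap_of_injective φ hφ)
    fun a ha => h.mem_of_commute (k := 2) ?_ (hc a)
  rw [← map_pow, pow_four_eq_one_of_sq_eq_neg_one (sq_eq_neg_one_of_trace_eq_zero ha), map_one]

/-- The embedding `s ↦ diag(s, 1)`. -/
def diagLeft : SLTwo F →* SpU F where
  toFun s := diagU s 1
  map_one' := diagU_one_one
  map_mul' a b := by simp

/-- The embedding `s ↦ diag(1, s)`. -/
def diagRight : SLTwo F →* SpU F where
  toFun s := diagU 1 s
  map_one' := diagU_one_one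
  map_mul' a b := by simp

/-- The embedding `s ↦ diag(s, s)`. -/
def diagDiag : SLTwo F →* SpU F where
  toFun s := diagU s s
  map_one' := diagU_one_one
  map_mul' a b := by simp

section

variable [Fintype F] {P : Subgroup (SpU F)} {a b : SLTwo F}

theorem not_isTop_diagU_left (hF : 4 ≤ Fintype.card F) (h2 : (2 : F) ≠ 0)
    (ha : a = 1 ∨ a = -1) : ¬ IsTopTwoSubgroup (diagU a b) P := fun h =>
  false_of_isTop_of_commute hF h2 h diagLeft (fun s t hst => (diagU_inj.mp hst).1) fun s => by
    rcases ha with rfl | rfl <;> simp [diagLeft, Commute, SemiconjBy]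

theorem not_isTop_diagU_right (hF : 4 ≤ Fintype.card F) (h2 : (2 : F) ≠ 0)
    (hb : b = 1 ∨ b = -1) : ¬ IsTopTwoSubgroup (diagU a b) P := fun h =>
  false_of_isTop_of_commute hF h2 h diagRight (fun s t hst => (diagU_inj.mp hst).2) fun s => by
    rcases hb with rfl | rfl <;> simp [diagRight, Commute, SemiconjBy]

theorem not_isTop_antiU (hF : 4 ≤ Fintype.card F) (h2 : (2 : F) ≠ 0)
    (ha : a = 1 ∨ a = -1) : ¬ IsTopTwoSubgroup (antiU a 1) P := fun h =>
  false_of_isTop_of_commute hF h2 h diagDiag (fun s t hst => (diagU_inj.mp hst).1) fun s => by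
    rcases ha with rfl | rfl <;> simp [diagDiag, Commute, SemiconjBy]

end

theorem exists_eq_diagU {y : SpU F} (h1 : y.1 0 1 = 0) (h2 : y.1 1 0 = 0) :
    ∃ a b : SLTwo F, y = diagU a b := by
  have hy := mem_SpU_iff.mp y.2
  rw [Matrix.eta_fin_two y.1, h1, h2, star_block, Matrix.mul_fin_two, one_block] at hy
  have h3 : (y.1 0 0) * star (y.1 0 0) = 1 := by simpa using congrFun (congrFun hy 0) 0
  have h4 : (y.1 1 1) * star (y.1 1 1) = 1 := by simpa using congrFun (congrFun hy 1) 1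
  refine ⟨⟨y.1 0 0, Unitary.mem_iff.mpr ⟨mul_eq_one_comm.mp h3, h3⟩⟩,
    ⟨y.1 1 1, Unitary.mem_iff.mpr ⟨mul_eq_one_comm.mp h4, h4⟩⟩, Subtype.ext ?_⟩
  rw [coe_diagU]
  nth_rewrite 1 [Matrix.eta_fin_two y.1]
  rw [h1, h2]

theorem exists_eq_antiU {y : SpU F} (h1 : y.1 0 0 = 0) (h2 : y.1 1 1 = 0) :
    ∃ a b : SLTwo F, y = antiU a b := by
  have hy := mem_SpU_iff.mp y.2
  rw [Matrix.eta_fin_two y.1, h1, h2, star_block, Matrix.mul_fin_two, one_block] at hy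
  have h3 : (y.1 0 1) * star (y.1 0 1) = 1 := by simpa using congrFun (congrFun hy 0) 0
  have h4 : (y.1 1 0) * star (y.1 1 0) = 1 := by simpa using congrFun (congrFun hy 1) 1
  refine ⟨⟨y.1 0 1, Unitary.mem_iff.mpr ⟨mul_eq_one_comm.mp h3, h3⟩⟩,
    ⟨y.1 1 0, Unitary.mem_iff.mpr ⟨mul_eq_one_comm.mp h4, h4⟩⟩, Subtype.ext ?_⟩
  rw [coe_antiU]
  nth_rewrite 1 [Matrix.eta_fin_two y.1]
  rw [h1, h2]

/-- The stabilizer of the orthogonal decomposition defining `SL₂ × SL₂ ≤ Sp₄`. -/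
def monomial (F : Type*) [Field F] : Subgroup (SpU F) where
  carrier := {y | ∃ a b : SLTwo F, y = diagU a b ∨ y = antiU a b}
  one_mem' := ⟨1, 1, Or.inl diagU_one_one.symm⟩
  mul_mem' := by
    rintro _ _ ⟨a, b, rfl | rfl⟩ ⟨c, d, rfl | rfl⟩
    exacts [⟨_, _, Or.inl (diagU_mul_diagU ..)⟩, ⟨_, _, Or.inr (diagU_mul_antiU ..)⟩,
      ⟨_, _, Or.inr (antiU_mul_diagU ..)⟩, ⟨_, _, Or.inl (antiU_mul_antiU ..)⟩]
  inv_mem' := by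
    rintro _ ⟨a, b, rfl | rfl⟩
    exacts [⟨_, _, Or.inl (diagU_inv ..)⟩, ⟨_, _, Or.inr (antiU_inv ..)⟩]

theorem mem_monomial {y : SpU F} :
    y ∈ monomial F ↔ ∃ a b : SLTwo F, y = diagU a b ∨ y = antiU a b := Iff.rfl

theorem eq_one_or_neg_one_of_sq (h2 : (2 : F) ≠ 0) {a : SLTwo F} (ha : a ^ 2 = 1) :
    a = 1 ∨ a = -1 := by
  refine eq_one_or_neg_one_of_trace_sq h2 (k := 1) (by simpa using ha) ?_
  have h : (a : Mat F) * a = 1 := by rw [← Submonoid.coe_mul, ← pow_two, ha, OneMemClass.coe_one]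
  have h' := congrArg Matrix.trace (mul_self_eq a)
  rw [h] at h'
  simp only [Matrix.trace_sub, Matrix.trace_smul, Matrix.trace_one, smul_eq_mul,
    Fintype.card_fin] at h'
  push_cast at h'
  linear_combination -h'

theorem diagU_neg_one_mul (y : SpU F) : diagU (-1) (-1) * y = -y := by
  refine Subtype.ext ?_
  rw [Submonoid.coe_mul, coe_diagU, Unitary.coe_neg, Unitary.coe_neg, OneMemClass.coe_one]
  have : (!![-1, 0; 0, -1] : Matrix (Fin 2) (Fin 2) (Mat F)) = -1 := by
    ext i j : 2
    fin_cases i <;> fin_cases j <;> simp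
  rw [this, neg_one_mul]

theorem coe_mul_diagU (y : SpU F) (u v : SLTwo F) :
    ((y * diagU u v : SpU F) : Matrix (Fin 2) (Fin 2) (Mat F)) =
      !![y.1 0 0 * u, y.1 0 1 * v; y.1 1 0 * u, y.1 1 1 * v] := by
  rw [Submonoid.coe_mul, coe_diagU]
  nth_rewrite 1 [Matrix.eta_fin_two y.1]
  simp only [Matrix.mul_fin_two, mul_zero, zero_add, add_zero]

theorem coe_diagU_mul (y : SpU F) (u v : SLTwo F) :
    ((diagU u v * y : SpU F) : Matrix (Fin 2) (Fin 2) (Mat F)) =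
      !![u * y.1 0 0, u * y.1 0 1; v * y.1 1 0, v * y.1 1 1] := by
  rw [Submonoid.coe_mul, coe_diagU]
  nth_rewrite 1 [Matrix.eta_fin_two y.1]
  simp only [Matrix.mul_fin_two, zero_mul, zero_add, add_zero]

theorem eq_zero_of_eq_neg_self (h2 : (2 : F) ≠ 0) {A : Mat F} (h : A = -A) : A = 0 := by
  have : (2 : F) • A = 0 := by rw [two_smul]; nth_rewrite 1 [h]; simp
  exact (smul_eq_zero.mp this).resolve_left h2

theorem IsPGroup.le_monomial [Finite F] (h2 : (2 : F) ≠ 0) {Q : Subgroup (SpU F)}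
    (hQ : IsPGroup 2 Q) {g : SLTwo F} (hg : g ^ 2 = -1) (hgQ : diagU g 1 ∈ Q) :
    Q ≤ monomial F := by
  refine _root_.IsPGroup.le_of_forall_conj_mem hQ fun y _ hy => ?_
  have hsq : (y * diagU g 1 * y⁻¹) ^ 2 = y * diagU (-1) 1 * y⁻¹ := by
    rw [conj_pow, diagU_pow, hg, one_pow]
  obtain ⟨u, v, huv⟩ : ∃ u v, y * diagU (-1) 1 * y⁻¹ = diagU u v := by
    rw [← hsq]
    obtain ⟨s, t, h | h⟩ := mem_monomial.mp (hy _ hgQ (mem_monomial.mpr ⟨g, 1, Or.inl rfl⟩))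
    · exact ⟨s ^ 2, t ^ 2, by rw [h, diagU_pow]⟩
    · exact ⟨s * t, t * s, by rw [h, pow_two, antiU_mul_antiU]⟩
  have huv2 : diagU (u ^ 2) (v ^ 2) = 1 := by
    rw [← diagU_pow, ← huv, conj_pow, diagU_pow, neg_one_sq, one_pow, diagU_one_one, mul_one,
      mul_inv_cancel]
  obtain ⟨hu, hv⟩ := diagU_eq_one.mp huv2
  have hc := mul_inv_eq_iff_eq_mul.mp huv
  have hc' := congrArg Subtype.val hc
  rw [coe_mul_diagU, coe_diagU_mul] at hc'
  have h00 := congrFun (congrFun hc' 0) 0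
  have h01 := congrFun (congrFun hc' 0) 1
  have h10 := congrFun (congrFun hc' 1) 0
  have h11 := congrFun (congrFun hc' 1) 1
  have hne : (diagU (-1) 1 : SpU F) ≠ diagU 1 1 := fun h => by
    have := congrArg (fun a : SLTwo F => a.1 0 0) (diagU_inj.mp h).1
    simp at this
    exact h2 (by linear_combination -this)
  have hne' : (diagU (-1) 1 : SpU F) ≠ diagU (-1) (-1) := fun h => by
    have := congrArg (fun a : SLTwo F => a.1 0 0) (diagU_inj.mp h).2
    simp at this
    exact h2 (by linear_combination this)
  rcases eq_one_or_neg_one_of_sq h2 hu with rfl | rfl <;>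
    rcases eq_one_or_neg_one_of_sq h2 hv with rfl | rfl
  · exact absurd (mul_left_cancel (hc.trans (by rw [diagU_one_one, one_mul, mul_one]))) hne
  · obtain ⟨a, b, h⟩ := exists_eq_antiU (y := y)
      (eq_zero_of_eq_neg_self h2 (by simpa using h00.symm))
      (eq_zero_of_eq_neg_self h2 (by simpa using h11))
    exact mem_monomial.mpr ⟨a, b, Or.inr h⟩
  · obtain ⟨a, b, h⟩ := exists_eq_diagU (y := y)
      (eq_zero_of_eq_neg_self h2 (by simpa using h01))
      (eq_zero_of_eq_neg_self h2 (by simpa using h10.symm))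
    exact mem_monomial.mpr ⟨a, b, Or.inl h⟩
  · refine absurd (mul_left_cancel (hc.trans ?_)) hne'
    rw [diagU_neg_one_mul]
    refine Subtype.ext ?_
    rw [coe_mul_diagU, Unitary.coe_neg]
    ext i j : 2
    fin_cases i <;> fin_cases j <;> simp

end Obstructions

section Clifford

/-- Every element of `2`-power order of `Sp₄` is conjugate to a monomial one. -/
theorem exists_conj_mem_monomial [Finite F] (h2 : (2 : F) ≠ 0) {x : SpU F} {k : ℕ}
    (hx : x ^ 2 ^ k = 1) : ∃ g : SpU F, g * x * g⁻¹ ∈ monomial F := by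
  have : Fact (Nat.Prime 2) := ⟨Nat.prime_two⟩
  let j : SLTwo F := rotS 0 1 (by simp)
  have hj : j ^ 2 = -1 := sq_eq_neg_one_of_trace_eq_zero (by simp [j])
  obtain ⟨S, hS⟩ := (isPGroup_zpowers (y := (diagU j 1 : SpU F)) (k := 2) (by
    rw [diagU_pow, pow_four_eq_one_of_sq_eq_neg_one hj, one_pow, diagU_one_one])).exists_le_sylow
  obtain ⟨T, hT⟩ := (isPGroup_zpowers hx).exists_le_sylow
  obtain ⟨g, hg⟩ := MulAction.exists_smul_eq (SpU F) T S
  refine ⟨g, IsPGroup.le_monomial h2 S.isPGroup' hj (hS (Subgroup.mem_zpowers _)) ?_⟩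
  rw [← hg]
  exact Subgroup.smul_mem_pointwise_smul x (MulAut.conj g) T.1 (hT (Subgroup.mem_zpowers x))

theorem block_congr {R : Type*} {A B C D A' B' C' D' : R} (hA : A = A') (hB : B = B') (hC : C = C')
    (hD : D = D') : !![A, B; C, D] = !![A', B'; C', D'] := by
  rw [hA, hB, hC, hD]

theorem half_mem (h2 : (2 : F) ≠ 0) :
    !![rot (1 / 2 : F) (-(1 / 2)), rot (1 / 2) (-(1 / 2));
      rot (1 / 2) (-(1 / 2)), -rot (1 / 2) (-(1 / 2))] ∈
      unitary (Matrix (Fin 2) (Fin 2) (Mat F)) := by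
  refine mem_SpU_of ?_ ?_ ?_ <;>
    simp only [star_rot, rot_mul_rot, rot_add_rot, neg_rot] <;>
    simp only [← rot_one_zero, ← rot_zero_zero, rot_inj] <;>
    constructor <;> field_simp <;> norm_num

/-- An element of order `8` normalizing the centralizer of `diag(J, J)`. -/
def cliffordU (h2 : (2 : F) ≠ 0) : SpU F := ⟨_, half_mem h2⟩

theorem cliffordU_sq (h2 : (2 : F) ≠ 0) :
    cliffordU h2 ^ 2 = diagU (rotS 0 (-1) (by simp)) (rotS 0 (-1) (by simp)) := by
  refine Subtype.ext ?_
  simp only [pow_two, Submonoid.coe_mul, cliffordU, coe_diagU, coe_rotS, Matrix.mul_fin_two,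
    neg_rot, rot_mul_rot, rot_add_rot, ← rot_zero_zero]
  refine block_congr ?_ ?_ ?_ ?_ <;> rw [rot_inj] <;> constructor <;> field_simp <;> norm_num

theorem cliffordU_pow_eight (h2 : (2 : F) ≠ 0) : cliffordU h2 ^ 2 ^ 3 = 1 := by
  have hj : (rotS 0 (-1) (by simp) : SLTwo F) ^ 2 = -1 :=
    sq_eq_neg_one_of_trace_eq_zero (by simp)
  rw [show 2 ^ 3 = 2 * 2 ^ 2 by norm_num, pow_mul, cliffordU_sq, diagU_pow,
    pow_four_eq_one_of_sq_eq_neg_one hj, diagU_one_one]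

theorem diagU_mul_cliffordU_pow_three (h2 : (2 : F) ≠ 0) :
    (diagU 1 (rotS 0 1 (by simp)) * cliffordU h2) ^ 3 =
      diagU (rotS 0 (-1) (by simp)) (rotS 0 (-1) (by simp)) := by
  refine Subtype.ext ?_
  simp only [pow_succ, pow_zero, one_mul, Submonoid.coe_mul, cliffordU, coe_diagU, coe_rotS,
    Matrix.mul_fin_two, OneMemClass.coe_one, ← rot_one_zero,
    neg_rot, rot_mul_rot, rot_add_rot, ← rot_zero_zero]
  refine block_congr ?_ ?_ ?_ ?_ <;> rw [rot_inj] <;> constructor <;> field_simp <;> norm_num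

theorem cliffordU_notMem (h2 : (2 : F) ≠ 0) {P : Subgroup (SpU F)} (hP : IsPGroup 2 P)
    (hD : diagU 1 (rotS 0 1 (by simp)) ∈ P) : cliffordU h2 ∉ P := by
  intro hC
  obtain ⟨k, hk⟩ := hP.exists_pow_eq_one (mul_mem hD hC)
  obtain ⟨m, hm⟩ := exists_pow_three_pow_eq_self hk
  rw [diagU_mul_cliffordU_pow_three, diagU_pow] at hm
  have h := congrFun (congrFun (congrArg Subtype.val hm) 0) 1
  rw [coe_diagU_mul] at h
  have h' := congrFun (congrFun h 0) 0
  simp [cliffordU, rot] at h'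
  exact h2 h'.symm

variable {P : Subgroup (SpU F)} {α β : F} {h : α ^ 2 + β ^ 2 = 1}

theorem rotS_comm {γ δ : F} {h' : γ ^ 2 + δ ^ 2 = 1} :
    Commute (rotS α β h) (rotS γ δ h') := by
  refine Subtype.ext ?_
  simp only [Submonoid.coe_mul, coe_rotS, rot_mul_rot, rot_inj]
  constructor <;> ring

theorem diagU_one_rot_mem {a : SLTwo F} (hx : IsTopTwoSubgroup (diagU a (rotS α β h)) P) :
    diagU 1 (rotS 0 1 (by simp)) ∈ P := by
  refine hx.mem_of_commute (k := 2) ?_ ?_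
  · rw [diagU_pow, one_pow, pow_four_eq_one_of_sq_eq_neg_one
      (sq_eq_neg_one_of_trace_eq_zero (by simp)), diagU_one_one]
  · rw [Commute, SemiconjBy, diagU_mul_diagU, diagU_mul_diagU, one_mul, mul_one, rotS_comm.eq]

theorem not_isTop_diagU_self (h2 : (2 : F) ≠ 0) :
    ¬ IsTopTwoSubgroup (diagU (rotS α β h) (rotS α β h)) P := by
  intro hx
  refine cliffordU_notMem h2 hx.isPGroup (diagU_one_rot_mem hx)
    (hx.mem_of_commute (cliffordU_pow_eight h2) ?_)
  refine Subtype.ext ?_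
  simp only [Submonoid.coe_mul, cliffordU, coe_diagU, coe_rotS, Matrix.mul_fin_two, neg_rot,
    rot_mul_rot, mul_zero, zero_mul, add_zero, zero_add]
  refine block_congr ?_ ?_ ?_ ?_ <;> rw [rot_inj] <;> constructor <;> ring

theorem neg_rotS : -rotS α β h = rotS (-α) (-β) (by linear_combination h) :=
  Subtype.ext (neg_rot α β)

theorem antiU_one_one_mem {a : SLTwo F} (hx : IsTopTwoSubgroup (diagU a (-a)) P) :
    antiU 1 1 ∈ P := by
  have hneg : diagU (-1) (-1) ∈ P := hx.mem_of_commute (k := 1) (by simp [diagU_one_one])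
    (by simp [Commute, SemiconjBy])
  have h1 := mul_mem hneg hx.mem
  refine hx.mem_of_conj_mem (k := 1) (by simp [pow_two, diagU_one_one]) ?_
    (by simp [pow_two, Commute, SemiconjBy])
  simpa using h1

theorem not_isTop_diagU_neg (h2 : (2 : F) ≠ 0) :
    ¬ IsTopTwoSubgroup (diagU (rotS α β h) (-rotS α β h)) P := by
  intro hx
  have hx' := hx
  rw [neg_rotS] at hx'
  refine cliffordU_notMem h2 hx.isPGroup (diagU_one_rot_mem hx') ?_
  obtain ⟨k, hk⟩ := hx.isPGroup.exists_pow_eq_one hx.mem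
  rw [diagU_pow] at hk
  have ha : diagU (rotS α β h) (rotS α β h) ∈ P := by
    refine hx.mem_of_commute (k := k) ?_ (by simp [Commute, SemiconjBy])
    rw [diagU_pow, (diagU_eq_one.mp hk).1, diagU_one_one]
  refine hx.mem_of_conj_mem (cliffordU_pow_eight h2) ?_ ?_
  · have h1 := mul_mem ha (antiU_one_one_mem hx)
    rw [diagU_mul_antiU, mul_one] at h1
    convert h1 using 1
    rw [mul_inv_eq_iff_eq_mul]
    refine Subtype.ext ?_
    simp only [Submonoid.coe_mul, cliffordU, coe_diagU, coe_antiU, coe_rotS, Matrix.mul_fin_two,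
      neg_rot, neg_rotS, rot_mul_rot, mul_zero, zero_mul, add_zero, zero_add]
    refine block_congr ?_ ?_ ?_ ?_ <;> rw [rot_inj] <;> constructor <;> ring
  · rw [cliffordU_sq, neg_rotS, Commute, SemiconjBy, diagU_mul_diagU, diagU_mul_diagU,
      rotS_comm.eq, (rotS_comm (α := 0)).eq]

end Clifford

section Antidiagonal

theorem block_add (A B C D A' B' C' D' : Mat F) :
    !![A, B; C, D] + !![A', B'; C', D'] = !![A + A', B + B'; C + C', D + D'] := by
  ext i j : 1
  fin_cases i <;> fin_cases j <;> rfl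

theorem block_smul (c : F) (A B C D : Mat F) :
    c • !![A, B; C, D] = !![c • A, c • B; c • C, c • D] := by
  ext i j : 1
  fin_cases i <;> fin_cases j <;> rfl

theorem cliffordU_mul_diagU (h2 : (2 : F) ≠ 0) {α β : F} {h : α ^ 2 + β ^ 2 = 1} :
    cliffordU h2 * diagU (rotS α β h) (-rotS α β h) =
      antiU (rotS α β h) (rotS α β h) * cliffordU h2 := by
  refine Subtype.ext ?_
  simp only [Submonoid.coe_mul, cliffordU, coe_diagU, coe_antiU, coe_rotS, Matrix.mul_fin_two,
    neg_rot, neg_rotS, rot_mul_rot, mul_zero, zero_mul, add_zero, zero_add]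
  refine block_congr ?_ ?_ ?_ ?_ <;> rw [rot_inj] <;> constructor <;> ring

theorem exists_mul_self_eq_rotS (h2 : (2 : F) ≠ 0) {α β r : F} {h : α ^ 2 + β ^ 2 = 1} (hβ : β ≠ 0)
    (hr : 2 - 2 * α = r * r) :
    ∃ (γ δ : F) (h' : γ ^ 2 + δ ^ 2 = 1), rotS γ δ h' * rotS γ δ h' = rotS α β h := by
  have hr0 : r ≠ 0 := by
    rintro rfl
    have h1 : 1 - α = 0 :=
      (mul_eq_zero.mp (by linear_combination hr : 2 * (1 - α) = 0)).resolve_left h2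
    exact hβ (by simpa using (by linear_combination h + (1 + α) * h1 : β ^ 2 = 0))
  have h' : (β / r) ^ 2 + ((1 - α) / r) ^ 2 = 1 := by
    field_simp
    linear_combination h + hr
  refine ⟨β / r, (1 - α) / r, h', Subtype.ext ?_⟩
  rw [Submonoid.coe_mul, coe_rotS, coe_rotS, rot_mul_rot, rot_inj]
  constructor
  · field_simp
    linear_combination h + α * hr
  · field_simp
    linear_combination hr

theorem not_isTop_antiU_rot_of_isSquare (h2 : (2 : F) ≠ 0) {α β : F} {h : α ^ 2 + β ^ 2 = 1}
    (hβ : β ≠ 0) (hsq : IsSquare (2 - 2 * α)) {P : Subgroup (SpU F)} :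
    ¬ IsTopTwoSubgroup (antiU (rotS α β h) 1) P := by
  intro hx
  obtain ⟨r, hr⟩ := hsq
  obtain ⟨γ, δ, h', he⟩ := exists_mul_self_eq_rotS h2 (h := h) hβ hr
  obtain ⟨P', hP'⟩ := hx.conj (diagU (rotS γ δ h')⁻¹ 1)
  rw [← he, diagU_mul_antiU, inv_mul_cancel_left, diagU_inv, inv_inv, inv_one, antiU_mul_diagU,
    mul_one, mul_one, one_mul] at hP'
  obtain ⟨P'', hP''⟩ := hP'.conj (cliffordU h2)⁻¹
  rw [inv_inv, mul_assoc, ← cliffordU_mul_diagU, inv_mul_cancel_left] at hP''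
  exact not_isTop_diagU_neg h2 hP''

theorem exists_ne_zero_one_neg_one [Fintype F] (hF : 4 ≤ Fintype.card F) :
    ∃ t : F, t ≠ 0 ∧ t ≠ 1 ∧ t ≠ -1 := by
  classical
  obtain ⟨t, ht⟩ : ∃ t : F, t ∉ ({0, 1, -1} : Finset F) := by
    by_contra! h
    have h3 := Finset.card_le_three (a := (0 : F)) (b := 1) (c := -1)
    rw [Finset.eq_univ_iff_forall.mpr h, Finset.card_univ] at h3
    omega
  exact ⟨t, by simpa using ht⟩

theorem diagU_one_neg_one_mem {c : SLTwo F} {P : Subgroup (SpU F)}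
    (hx : IsTopTwoSubgroup (antiU c 1) P) : diagU 1 (-1) ∈ P := by
  have hneg : diagU (-1) (-1) ∈ P := hx.mem_of_commute (k := 1) (by simp [diagU_one_one])
    (by simp [Commute, SemiconjBy])
  refine hx.mem_of_conj_mem (k := 1) (by simp [diagU_one_one]) ?_
    (by simp [Commute, SemiconjBy])
  have hinv : (-1 : SLTwo F)⁻¹ = -1 := inv_eq_of_mul_eq_one_left (by simp)
  have h1 := mul_mem hneg hx.mem
  simpa [hinv] using h1

theorem not_isTop_antiU_rot_of_not_isSquare [Fintype F] (hF : 4 ≤ Fintype.card F)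
    (h2 : (2 : F) ≠ 0) {α β : F} {h : α ^ 2 + β ^ 2 = 1}
    (hsq : ¬ IsSquare (2 - 2 * α)) {P : Subgroup (SpU F)} :
    ¬ IsTopTwoSubgroup (antiU (rotS α β h) 1) P := by
  intro hx
  have hα : 2 - 2 * α ≠ 0 := fun h => hsq (h ▸ ⟨0, by simp⟩)
  have h4 : (4 : F) ≠ 0 := by
    rw [show (4 : F) = 2 * 2 by norm_num]; exact mul_ne_zero h2 h2
  obtain ⟨t, ht0, hts⟩ : ∃ t : F, t ≠ 0 ∧ t ^ 2 * (2 * α - 2) ≠ 1 := by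
    obtain ⟨t, ht0, ht1, ht2⟩ := exists_ne_zero_one_neg_one hF
    by_cases h1 : 2 * α - 2 = 1
    · refine ⟨t, ht0, fun h => ?_⟩
      rcases mul_eq_zero.mp (by linear_combination h - t ^ 2 * h1 : (t - 1) * (t + 1) = 0)
        with h | h
      · exact ht1 (sub_eq_zero.mp h)
      · exact ht2 (eq_neg_of_add_eq_zero_left h)
    · exact ⟨1, one_ne_zero, by simpa using h1⟩
  obtain ⟨s, hs⟩ : ∃ s, s = t ^ 2 * (2 * α - 2) := ⟨_, rfl⟩
  rw [← hs] at hts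
  have hs1 : s - 1 ≠ 0 := sub_ne_zero.mpr hts
  obtain ⟨m, hm⟩ : ∃ m, m = (s + 1) / (s - 1) := ⟨_, rfl⟩
  obtain ⟨ν, hν⟩ : ∃ ν, ν = 2 * t / (s - 1) := ⟨_, rfl⟩
  have hmν : m ^ 2 + ν ^ 2 * (2 - 2 * α) = 1 := by
    rw [hm, hν]
    field_simp
    linear_combination 4 * hs
  let Y : SpU F := ⟨!![rot m 0, rot (ν * (α - 1)) (ν * β); rot (ν * (α - 1)) (-(ν * β)),
    rot (-m) 0], by
    refine mem_SpU_of ?_ ?_ ?_ <;>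
      simp only [star_rot, rot_mul_rot, rot_add_rot] <;>
      simp only [← rot_one_zero, ← rot_zero_zero, rot_inj] <;> constructor
    · linear_combination hmν + ν ^ 2 * h
    · ring
    · ring
    · ring
    · linear_combination hmν + ν ^ 2 * h
    · ring⟩
  have hY2 : Y ^ 2 = 1 := by
    refine Subtype.ext ?_
    simp only [Y, pow_two, Submonoid.coe_mul, Matrix.mul_fin_two, rot_mul_rot, rot_add_rot,
      OneMemClass.coe_one, one_block, ← rot_one_zero, ← rot_zero_zero]
    refine block_congr ?_ ?_ ?_ ?_ <;> rw [rot_inj] <;> constructor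
    · linear_combination hmν + ν ^ 2 * h
    · ring
    · ring
    · ring
    · ring
    · ring
    · linear_combination hmν + ν ^ 2 * h
    · ring
  have hneg : diagU (-1) (-1) ∈ P := hx.mem_of_commute (k := 1) (by simp [diagU_one_one])
    (by simp [Commute, SemiconjBy])
  have hYP : Y ∈ P := by
    refine hx.mem_of_conj_mem (k := 1) (by simpa using hY2) ?_
      (by rw [hY2]; exact Commute.one_left _)
    have h1 : Y * antiU (rotS α β h) 1 * Y⁻¹ = diagU (-1) (-1) * antiU (rotS α β h) 1 := by
      rw [mul_inv_eq_iff_eq_mul, diagU_mul_antiU]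
      refine Subtype.ext ?_
      simp only [Y, Submonoid.coe_mul, Matrix.mul_fin_two, coe_antiU, coe_rotS, neg_mul, one_mul,
        mul_one, mul_zero, zero_mul, zero_add, add_zero, neg_rotS, neg_rot,
        OneMemClass.coe_one, coe_neg_one,
        rot_mul_rot]
      refine block_congr ?_ ?_ ?_ ?_ <;> rw [rot_inj] <;> constructor
      · linear_combination ν * h
      · ring
      · ring
      · ring
      · ring
      · ring
      · linear_combination ν * h
      · ring
    rw [h1]
    exact mul_mem hneg hx.mem
  obtain ⟨k, hk⟩ := hx.isPGroup.exists_pow_eq_one (mul_mem hYP (diagU_one_neg_one_mem hx))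
  have hz := congrArg Subtype.val hk
  rw [SubmonoidClass.coe_pow, OneMemClass.coe_one] at hz
  obtain ⟨w, hw⟩ := isSquare_four_sub_sq (F := F) k _ (2 * m) (by
    refine eq_sub_of_add_eq ?_
    simp only [Submonoid.coe_mul, Y, coe_diagU, coe_neg_one, OneMemClass.coe_one,
      Matrix.mul_fin_two, one_block, ← rot_one_zero, ← rot_zero_zero, neg_rot, rot_mul_rot,
      rot_add_rot, block_add, block_smul, smul_rot]
    refine block_congr ?_ ?_ ?_ ?_ <;> rw [rot_inj] <;> constructor
    · linear_combination -hmν - ν ^ 2 * h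
    · ring
    · ring
    · ring
    · ring
    · ring
    · linear_combination -hmν - ν ^ 2 * h
    · ring) hz (fun h => by
      rw [hm] at h
      field_simp at h
      have h' : (4 * 4) * t ^ 2 * (2 - 2 * α) = 0 := by linear_combination -h + 16 * hs
      simp [h4, ht0, hα] at h')
  refine hsq ⟨w * (s - 1) / (4 * t), ?_⟩
  rw [hm] at hw
  field_simp at hw ⊢
  linear_combination hw + 16 * hs

theorem isTop_antiU_pow {c : SLTwo F} {P : Subgroup (SpU F)}
    (hx : IsTopTwoSubgroup (antiU c 1) P) : ∃ k, c ^ 2 ^ k = 1 := by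
  obtain ⟨k, hk⟩ := hx.isPGroup.exists_pow_eq_one (mul_mem hx.mem hx.mem)
  rw [antiU_mul_antiU, diagU_pow, diagU_eq_one] at hk
  exact ⟨k, by simpa using hk.1⟩

theorem exists_conj_rotS [Fintype F] (hF : Odd (Fintype.card F)) (h2 : (2 : F) ≠ 0)
    {a : SLTwo F} {k : ℕ} (ha : a ^ 2 ^ k = 1) (h1 : a ≠ 1) (h1' : a ≠ -1) :
    ∃ (s : SLTwo F) (α β : F) (h : α ^ 2 + β ^ 2 = 1), β ≠ 0 ∧ s * a * s⁻¹ = rotS α β h := by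
  have ht : (a : Mat F).trace ^ 2 ≠ 4 := fun ht =>
    (eq_one_or_neg_one_of_trace_sq h2 ha ht).elim h1 h1'
  refine exists_conj_eq_rot hF h2 a (isSquare_four_sub_sq k _ _ (mul_self_eq a) ?_ ht) ht
  rw [← SubmonoidClass.coe_pow, ha, OneMemClass.coe_one]

theorem not_isTop_antiU_one [Fintype F] (hodd : Odd (Fintype.card F)) (hF : 4 ≤ Fintype.card F)
    (h2 : (2 : F) ≠ 0) {c : SLTwo F} {P : Subgroup (SpU F)} :
    ¬ IsTopTwoSubgroup (antiU c 1) P := by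
  intro hx
  obtain ⟨k, hk⟩ := isTop_antiU_pow hx
  by_cases h1 : c = 1
  · exact not_isTop_antiU hF h2 (Or.inl h1) hx
  by_cases h1' : c = -1
  · exact not_isTop_antiU hF h2 (Or.inr h1') hx
  obtain ⟨s, α, β, h, hβ, hs⟩ := exists_conj_rotS hodd h2 hk h1 h1'
  obtain ⟨P', hP'⟩ := hx.conj (diagU s s)
  rw [diagU_mul_antiU, diagU_inv, antiU_mul_diagU, hs, mul_one, mul_inv_cancel] at hP'
  by_cases hsq : IsSquare (2 - 2 * α)
  · exact not_isTop_antiU_rot_of_isSquare h2 hβ hsq hP'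
  · exact not_isTop_antiU_rot_of_not_isSquare hF h2 hsq hP'

theorem not_isTop_antiU_any [Fintype F] (hodd : Odd (Fintype.card F)) (hF : 4 ≤ Fintype.card F)
    (h2 : (2 : F) ≠ 0) {a b : SLTwo F} {P : Subgroup (SpU F)} :
    ¬ IsTopTwoSubgroup (antiU a b) P := by
  intro hx
  obtain ⟨P', hP'⟩ := hx.conj (diagU 1 b⁻¹)
  rw [diagU_mul_antiU, diagU_inv, antiU_mul_diagU, inv_mul_cancel, inv_one, mul_one] at hP'
  exact not_isTop_antiU_one hodd hF h2 hP'

end Antidiagonal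

section Diagonal

/-- The symmetric trace zero matrices. -/
def refl (p r : F) : Mat F := !![p, r; r, -p]

@[simp] theorem rot_mul_refl (α β p r : F) :
    rot α β * refl p r = refl (α * p - β * r) (α * r + β * p) := by
  simp only [rot, refl, Matrix.mul_fin_two]
  refine block_congr ?_ ?_ ?_ ?_ <;> ring

@[simp] theorem refl_mul_rot (p r α β : F) :
    refl p r * rot α β = refl (p * α + r * β) (r * α - p * β) := by
  simp only [rot, refl, Matrix.mul_fin_two]
  refine block_congr ?_ ?_ ?_ ?_ <;> ring

@[simp] theorem refl_mul_refl (p r p' r' : F) :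
    refl p r * refl p' r' = rot (p * p' + r * r') (r * p' - p * r') := by
  simp only [rot, refl, Matrix.mul_fin_two]
  refine block_congr ?_ ?_ ?_ ?_ <;> ring

@[simp] theorem trace_refl (p r : F) : (refl p r).trace = 0 := by
  simp [refl, Matrix.trace_fin_two]

@[simp] theorem det_refl (p r : F) : (refl p r).det = -(p ^ 2 + r ^ 2) := by
  simp [refl, Matrix.det_fin_two]; ring

theorem refl_inj {p r p' r' : F} : refl p r = refl p' r' ↔ p = p' ∧ r = r' := by
  refine ⟨fun h => ⟨by simpa [refl] using congrFun (congrFun h 0) 0,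
    by simpa [refl] using congrFun (congrFun h 1) 0⟩, fun ⟨h1, h2⟩ => by rw [h1, h2]⟩

/-- The symmetric trace zero matrices of determinant one. -/
def reflS (p r : F) (h : p ^ 2 + r ^ 2 = -1) : SLTwo F :=
  ⟨refl p r, mem_SLTwo_iff.mpr (by rw [det_refl, h, neg_neg])⟩

@[simp] theorem coe_reflS (p r : F) (h : p ^ 2 + r ^ 2 = -1) :
    ((reflS p r h : SLTwo F) : Mat F) = refl p r := rfl

theorem reflS_sq {p r : F} {h : p ^ 2 + r ^ 2 = -1} : reflS p r h ^ 2 = -1 :=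
  sq_eq_neg_one_of_trace_eq_zero (by simp)

theorem exists_reflS [Fintype F] (hF : Odd (Fintype.card F)) (h2 : (2 : F) ≠ 0) :
    ∃ p r : F, p ^ 2 + r ^ 2 = -1 := by
  obtain ⟨p, r, h⟩ := exists_binary_quadratic_eq hF h2 (A := 1) (B := 0) (C := 1) (by
    rw [show (0 : F) ^ 2 - 4 * 1 * 1 = -(2 * 2) by norm_num]
    exact neg_ne_zero.mpr (mul_ne_zero h2 h2)) (-1)
  exact ⟨p, r, by linear_combination h⟩

theorem reflS_conj_rotS {p r α β : F} {h : p ^ 2 + r ^ 2 = -1} {h' : α ^ 2 + β ^ 2 = 1} :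
    reflS p r h * rotS α β h' * (reflS p r h)⁻¹ = rotS α (-β) (by linear_combination h') := by
  rw [mul_inv_eq_iff_eq_mul]
  refine Subtype.ext ?_
  simp only [Submonoid.coe_mul, coe_reflS, coe_rotS, refl_mul_rot, rot_mul_refl, refl_inj]
  constructor <;> ring

/-- The rotation subgroup of `SL₂(F)`. -/
def rotations (F : Type*) [Field F] : Subgroup (SLTwo F) where
  carrier := {a | ∃ α β h, a = rotS α β h}
  one_mem' := ⟨1, 0, by simp, Subtype.ext rot_one_zero.symm⟩
  mul_mem' := by
    rintro _ _ ⟨α, β, h, rfl⟩ ⟨γ, δ, h', rfl⟩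
    exact ⟨α * γ - β * δ, α * δ + β * γ,
      by linear_combination (γ ^ 2 + δ ^ 2) * h + h', Subtype.ext (rot_mul_rot ..)⟩
  inv_mem' := by
    rintro _ ⟨α, β, h, rfl⟩
    exact ⟨α, -β, by linear_combination h, Subtype.ext (star_rot ..)⟩

theorem rotS_mem {α β : F} {h : α ^ 2 + β ^ 2 = 1} : rotS α β h ∈ rotations F := ⟨α, β, h, rfl⟩

variable {P : Subgroup (SpU F)} {α β : F} {h : α ^ 2 + β ^ 2 = 1} {b : SLTwo F}

theorem isTop_diagU_pow {a : SLTwo F} (hx : IsTopTwoSubgroup (diagU a b) P) :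
    ∃ k, a ^ 2 ^ k = 1 ∧ b ^ 2 ^ k = 1 := by
  obtain ⟨k, hk⟩ := hx.isPGroup.exists_pow_eq_one hx.mem
  rw [diagU_pow, diagU_eq_one] at hk
  exact ⟨k, hk⟩

theorem diagU_left_mem {a c : SLTwo F} (hx : IsTopTwoSubgroup (diagU a b) P) {k : ℕ}
    (hc : c ^ 2 ^ k = 1) (hca : Commute c a) : diagU c 1 ∈ P :=
  hx.mem_of_commute (k := k) (by rw [diagU_pow, hc, one_pow, diagU_one_one])
    (by rw [Commute, SemiconjBy, diagU_mul_diagU, diagU_mul_diagU, hca.eq, one_mul, mul_one])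

theorem diagU_left_mem_of_conj {a y : SLTwo F} (hx : IsTopTwoSubgroup (diagU a b) P)
    (hy : y ^ 2 = -1) (hyx : diagU (y * a * y⁻¹) 1 ∈ P) : diagU y 1 ∈ P := by
  obtain ⟨k, hka, hkb⟩ := isTop_diagU_pow hx
  have hb : diagU 1 b ∈ P := hx.mem_of_commute (k := k)
    (by rw [diagU_pow, hkb, one_pow, diagU_one_one]) (by simp [Commute, SemiconjBy])
  refine hx.mem_of_conj_mem (k := 2) ?_ ?_ ?_
  · rw [diagU_pow, pow_four_eq_one_of_sq_eq_neg_one hy, one_pow, diagU_one_one]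
  · have := mul_mem hyx hb
    simpa using this
  · rw [diagU_pow, hy]
    simp [Commute, SemiconjBy]

theorem diagU_reflS_mem {p r : F} {hw : p ^ 2 + r ^ 2 = -1}
    (hx : IsTopTwoSubgroup (diagU (rotS α β h) b) P) : diagU (reflS p r hw) 1 ∈ P := by
  obtain ⟨k, hk, -⟩ := isTop_diagU_pow hx
  refine diagU_left_mem_of_conj hx reflS_sq (diagU_left_mem hx (k := k) ?_ ?_)
  · rw [conj_pow, hk, mul_one, mul_inv_cancel]
  · rw [reflS_conj_rotS]
    exact rotS_comm

theorem isPGroup_rotations [Fintype F] (hF : Odd (Fintype.card F)) (h2 : (2 : F) ≠ 0)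
    (hx : IsTopTwoSubgroup (diagU (rotS α β h) b) P) : IsPGroup 2 (rotations F) := by
  rintro ⟨_, γ, δ, h', rfl⟩
  obtain ⟨p, r, hw⟩ := exists_reflS hF h2
  have hw' : (γ * p - δ * r) ^ 2 + (γ * r + δ * p) ^ 2 = -1 := by
    linear_combination (γ ^ 2 + δ ^ 2) * hw - h'
  have hmul : rotS γ δ h' * reflS p r hw = reflS _ _ hw' := Subtype.ext (rot_mul_refl ..)
  have hm := mul_mem (diagU_reflS_mem (hw := hw') hx) (inv_mem (diagU_reflS_mem (hw := hw) hx))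
  rw [← hmul, diagU_inv, diagU_mul_diagU, mul_inv_cancel_right, inv_one, one_mul] at hm
  obtain ⟨k, hk⟩ := hx.isPGroup.exists_pow_eq_one hm
  rw [diagU_pow, diagU_eq_one] at hk
  exact ⟨k, Subtype.ext hk.1⟩

theorem not_isTop_diagU_of_trace_sq_eq [Fintype F] (hF : Odd (Fintype.card F)) (h2 : (2 : F) ≠ 0)
    {γ δ : F} {h' : γ ^ 2 + δ ^ 2 = 1} (hγ : γ ^ 2 = α ^ 2) :
    ¬ IsTopTwoSubgroup (diagU (rotS α β h) (rotS γ δ h')) P := by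
  intro hx
  obtain ⟨p, r, hw⟩ := exists_reflS hF h2
  obtain ⟨P', hx'⟩ := hx.conj (diagU 1 (reflS p r hw))
  rw [diagU_mul_diagU, diagU_inv, diagU_mul_diagU, reflS_conj_rotS, one_mul, inv_one,
    mul_one] at hx'
  have hδ : δ ^ 2 = β ^ 2 := by linear_combination h' - h - hγ
  rcases sq_eq_sq_iff_eq_or_eq_neg.mp hγ with rfl | rfl <;>
    rcases sq_eq_sq_iff_eq_or_eq_neg.mp hδ with rfl | rfl
  · exact not_isTop_diagU_self h2 hx
  · simp only [neg_neg] at hx'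
    exact not_isTop_diagU_self h2 hx'
  · rw [← neg_rotS (h := h)] at hx'
    exact not_isTop_diagU_neg h2 hx'
  · rw [← neg_rotS (h := h)] at hx
    exact not_isTop_diagU_neg h2 hx

theorem not_isTop_diagU_order_four [Fintype F] (hF : Odd (Fintype.card F)) (h2 : (2 : F) ≠ 0)
    (hα : α = 0) {s : F} (hs : s ^ 2 = 2) :
    ¬ IsTopTwoSubgroup (diagU (rotS α β h) b) P := by
  intro hx
  subst hα
  have hβ : β ^ 2 = 1 := by linear_combination h
  have hs0 : s ≠ 0 := by rintro rfl; exact h2 (by rw [← hs]; simp)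
  obtain ⟨p, r, hw⟩ := exists_reflS hF h2
  have hh : (1 / s) ^ 2 + (β / s) ^ 2 = 1 := by field_simp; linear_combination hβ - hs
  obtain ⟨k, hk⟩ := isPGroup_rotations hF h2 hx ⟨_, rotS_mem (h := hh)⟩
  have hH : diagU (rotS _ _ hh) 1 ∈ P := diagU_left_mem hx (congrArg Subtype.val hk) rotS_comm
  let y : SLTwo F := ⟨s⁻¹ • (rot 0 β + refl p r), mem_SLTwo_iff.mpr (by
    rw [Matrix.det_smul]
    simp [rot, refl, Matrix.det_fin_two]
    field_simp
    linear_combination -hw + hβ - hs)⟩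
  have hyt : (y : Mat F).trace = 0 := by simp [y, Matrix.trace_smul, Matrix.trace_add]
  have hyc : y * rotS 0 β h * y⁻¹ = reflS p r hw := by
    rw [mul_inv_eq_iff_eq_mul]
    refine Subtype.ext ?_
    simp only [Submonoid.coe_mul, coe_rotS, coe_reflS, y, smul_mul_assoc, mul_smul_comm, add_mul,
      mul_add, rot_mul_rot, refl_mul_rot, refl_mul_refl]
    rw [add_comm]
    congr 2
    rw [rot_inj]
    constructor
    · linear_combination -hw - hβ
    · ring
  have hY := diagU_left_mem_of_conj hx (sq_eq_neg_one_of_trace_eq_zero hyt)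
    (hyc ▸ diagU_reflS_mem hx)
  obtain ⟨l, hl⟩ := hx.isPGroup.exists_pow_eq_one (mul_mem hY hH)
  rw [diagU_mul_diagU, diagU_pow, diagU_eq_one] at hl
  have htr : ((y * rotS _ _ hh : SLTwo F) : Mat F).trace = -1 := by
    simp only [Submonoid.coe_mul, y, coe_rotS, smul_mul_assoc, add_mul, rot_mul_rot, refl_mul_rot,
      Matrix.trace_smul, Matrix.trace_add, trace_rot, trace_refl, smul_eq_mul]
    field_simp
    linear_combination -2 * hβ + hs
  have h3 : (y * rotS _ _ hh) ^ 3 = 1 := by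
    refine Subtype.ext ?_
    have := mul_self_eq (y * rotS _ _ hh)
    rw [htr] at this
    rw [SubmonoidClass.coe_pow, pow_succ, pow_two, this, sub_mul, smul_mul_assoc, this]
    simp
  obtain ⟨m, hm⟩ := exists_pow_three_pow_eq_self hl.1
  rw [h3, one_pow] at hm
  have hyh : y = (rotS _ _ hh)⁻¹ := eq_inv_of_mul_eq_one_left hm.symm
  obtain ⟨γ, δ, h', hγ⟩ := inv_mem (rotS_mem (h := hh))
  have hwa : reflS p r hw = rotS 0 β h := by
    rw [← hyc, hyh, hγ, rotS_comm.eq, mul_inv_cancel_right]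
  have h00 := congrFun (congrFun (congrArg Subtype.val hwa) 0) 1
  have h01 := congrFun (congrFun (congrArg Subtype.val hwa) 1) 0
  simp [rot, refl] at h00 h01
  have : 2 * β = 0 := by linear_combination h00 - h01
  rcases mul_eq_zero.mp this with h | h
  · exact h2 h
  · rw [h] at hβ; simp at hβ

end Diagonal

section Circle

/-- The rational parametrization of the circle. -/
noncomputable def circleEquiv (h2 : (2 : F) ≠ 0) :
    rotations F ≃ Option {m : F // m ^ 2 + 1 ≠ 0} := by
  classical
  refine (Equiv.symm ?_ : rotations F ≃ {p : F × F // p.1 ^ 2 + p.2 ^ 2 = 1}).trans ?_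
  · refine Equiv.ofBijective (fun p => ⟨rotS _ _ p.2, rotS_mem⟩) ⟨fun p p' hp => ?_, ?_⟩
    · have := rot_inj.mp (congrArg (fun a : rotations F => ((a : SLTwo F) : Mat F)) hp)
      exact Subtype.ext (Prod.ext this.1 this.2)
    · rintro ⟨_, α, β, h, rfl⟩
      exact ⟨⟨(α, β), h⟩, rfl⟩
  · exact
    { toFun := fun p => if hp : 1 + p.1.1 = 0 then none else
        some ⟨p.1.2 / (1 + p.1.1), fun h => by
          have := p.2
          field_simp at h
          exact hp ((mul_eq_zero.mp (by linear_combination h - this :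
            2 * (1 + p.1.1) = 0)).resolve_left h2)⟩
      invFun := fun o => match o with
        | none => ⟨(-1, 0), by simp⟩
        | some m => ⟨((1 - m ^ 2) / (m ^ 2 + 1), 2 * m / (m ^ 2 + 1)), by
            have := m.2
            field_simp
            ring⟩
      left_inv := by
        rintro ⟨⟨α, β⟩, h⟩
        dsimp only at h ⊢
        by_cases hp : 1 + α = 0
        · rw [dif_pos hp]
          have hα : α = -1 := by linear_combination hp
          have hβ : β ^ 2 = 0 := by linear_combination h - (α - 1) * hp
          have hβ : β = 0 := by simpa using hβ
          simp [hα, hβ]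
        · rw [dif_neg hp]
          have hd : β ^ 2 + (1 + α) ^ 2 = 2 * (1 + α) := by linear_combination h
          have hd0 : β ^ 2 + (1 + α) ^ 2 ≠ 0 := hd ▸ mul_ne_zero h2 hp
          ext
          · simp only
            field_simp
            linear_combination (-α - 1) * h
          · simp only
            field_simp
            linear_combination (-β) * h
      right_inv := by
        rintro (_ | ⟨m, hm⟩)
        · simp
        · have h1 : 1 + (1 - m ^ 2) / (m ^ 2 + 1) = 2 / (m ^ 2 + 1) := by
            field_simp
            ring
          have h0 : 1 + (1 - m ^ 2) / (m ^ 2 + 1) ≠ 0 := h1 ▸ div_ne_zero h2 hm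
          simp only
          rw [dif_neg h0]
          congr 2
          rw [h1]
          field_simp }

open scoped Classical in
theorem card_rotations [Fintype F] (h2 : (2 : F) ≠ 0) :
    Nat.card (rotations F) + (if IsSquare (-1 : F) then 1 else 0) =
      Fintype.card F + (if IsSquare (-1 : F) then 0 else 1) := by
  rw [Nat.card_congr (circleEquiv h2), Nat.card_eq_fintype_card, Fintype.card_option]
  have h := Fintype.card_subtype_compl (fun m : F => m ^ 2 + 1 = 0)
  have hle := Fintype.card_subtype_le (fun m : F => m ^ 2 + 1 = 0)
  have hc : Fintype.card {m : F // m ^ 2 + 1 = 0} = if IsSquare (-1 : F) then 2 else 0 := by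
    rw [Fintype.card_subtype]
    split_ifs with hsq
    · obtain ⟨i, hi⟩ := hsq
      rw [show (Finset.univ.filter fun m : F => m ^ 2 + 1 = 0) = {i, -i} by
        ext m
        simp only [Finset.mem_filter, Finset.mem_univ, true_and, Finset.mem_insert,
          Finset.mem_singleton]
        rw [← sq_eq_sq_iff_eq_or_eq_neg]
        exact ⟨fun h => by linear_combination h + hi, fun h => by linear_combination h - hi⟩]
      refine Finset.card_pair fun h => ?_
      have h0 : 2 * i = 0 := by linear_combination h
      have hi0 := (mul_eq_zero.mp h0).resolve_left h2
      rw [hi0] at hi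
      simp at hi
    · refine Finset.card_eq_zero.mpr (Finset.filter_eq_empty_iff.mpr fun m _ hm => hsq ⟨m, ?_⟩)
      linear_combination -hm
  change Fintype.card {m : F // ¬ (m ^ 2 + 1 = 0)} + 1 + _ = _
  rw [h]
  split_ifs at hc ⊢ <;> omega

end Circle

section Forward

theorem rotS_pow_eight_cases (h2 : (2 : F) ≠ 0) {α β : F} {h : α ^ 2 + β ^ 2 = 1} (hβ : β ≠ 0)
    (h8 : rotS α β h ^ 8 = 1) : α = 0 ∨ 2 * α ^ 2 = 1 := by
  have h4 : rotS α β h ^ 4 = 1 ∨ rotS α β h ^ 4 = -1 :=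
    eq_one_or_neg_one_of_sq h2 (by rw [← pow_mul, h8])
  have hc : ((rotS α β h ^ 4 : SLTwo F) : Mat F) 1 0 = 4 * α * β * (2 * α ^ 2 - 1) := by
    rw [show (4 : ℕ) = 2 + 2 from rfl, pow_add, pow_two]
    simp only [Submonoid.coe_mul, coe_rotS, rot_mul_rot]
    simp only [rot, Matrix.of_apply, Matrix.cons_val', Matrix.cons_val_zero, Matrix.cons_val_one]
    linear_combination (-4 * α * β) * h
  have h0 : 4 * α * β * (2 * α ^ 2 - 1) = 0 := by
    rw [← hc]
    rcases h4 with h4 | h4 <;> rw [h4] <;> simp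
  rw [show (4 : F) = 2 * 2 by norm_num] at h0
  simp only [mul_eq_zero, h2, hβ, or_false, false_or, sub_eq_zero] at h0
  exact h0

variable [Fintype F] {P : Subgroup (SpU F)}

theorem not_card_rotations_dvd_eight (hF : Odd (Fintype.card F)) (h2 : (2 : F) ≠ 0)
    {α β γ δ : F} {h : α ^ 2 + β ^ 2 = 1} {h' : γ ^ 2 + δ ^ 2 = 1} (hβ : β ≠ 0) (hδ : δ ≠ 0)
    (hx : IsTopTwoSubgroup (diagU (rotS α β h) (rotS γ δ h')) P) :
    ¬ Nat.card (rotations F) ∣ 8 := by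
  intro hdvd
  have h8 {α β : F} (h : α ^ 2 + β ^ 2 = 1) : rotS α β h ^ 8 = 1 := by
    have h1 : (⟨rotS α β h, rotS_mem⟩ : rotations F) ^ 8 = 1 := by
      obtain ⟨c, hc⟩ := hdvd
      rw [hc, pow_mul, pow_card_eq_one', one_pow]
    exact congrArg Subtype.val h1
  have hne : γ ^ 2 ≠ α ^ 2 := fun hγ => not_isTop_diagU_of_trace_sq_eq hF h2 hγ hx
  rcases rotS_pow_eight_cases h2 hβ (h8 h) with h0 | hα <;>
    rcases rotS_pow_eight_cases h2 hδ (h8 h') with h0' | hγ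
  · exact hne (by rw [h0, h0'])
  · exact not_isTop_diagU_order_four hF h2 h0 (s := 2 * γ) (by linear_combination 2 * hγ) hx
  · obtain ⟨P', hx'⟩ := hx.conj (antiU 1 1)
    rw [antiU_mul_diagU, antiU_inv, antiU_mul_antiU] at hx'
    simp only [one_mul, inv_one, mul_one] at hx'
    exact not_isTop_diagU_order_four hF h2 h0' (s := 2 * α) (by linear_combination 2 * hα) hx'
  · exact hne (mul_left_cancel₀ h2 (by rw [hα, hγ]))

theorem exists_isTop_diagU_rotS (hodd : Odd (Fintype.card F)) (hF : 4 ≤ Fintype.card F)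
    (h2 : (2 : F) ≠ 0) {x : SpU F} (hx : IsTopTwoSubgroup x P) :
    ∃ (α β γ δ : F) (h : α ^ 2 + β ^ 2 = 1) (h' : γ ^ 2 + δ ^ 2 = 1) (P' : Subgroup (SpU F)),
      β ≠ 0 ∧ δ ≠ 0 ∧ IsTopTwoSubgroup (diagU (rotS α β h) (rotS γ δ h')) P' := by
  obtain ⟨k, hk⟩ := hx.isPGroup.exists_pow_eq_one hx.mem
  obtain ⟨g, a, b, hab⟩ := exists_conj_mem_monomial h2 hk
  obtain ⟨P₁, hx₁⟩ := hx.conj g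
  rcases hab with hab | hab <;> rw [hab] at hx₁
  swap
  · exact absurd hx₁ (not_isTop_antiU_any hodd hF h2)
  obtain ⟨m, ha, hb⟩ := isTop_diagU_pow hx₁
  obtain ⟨s, α, β, h, hβ, hs⟩ := exists_conj_rotS hodd h2 ha
    (fun h => not_isTop_diagU_left hF h2 (Or.inl h) hx₁)
    (fun h => not_isTop_diagU_left hF h2 (Or.inr h) hx₁)
  obtain ⟨t, γ, δ, h', hδ, ht⟩ := exists_conj_rotS hodd h2 hb
    (fun h => not_isTop_diagU_right hF h2 (Or.inl h) hx₁)
    (fun h => not_isTop_diagU_right hF h2 (Or.inr h) hx₁)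
  obtain ⟨P₂, hx₂⟩ := hx₁.conj (diagU s t)
  rw [diagU_mul_diagU, diagU_inv, diagU_mul_diagU, hs, ht] at hx₂
  exact ⟨α, β, γ, δ, h, h', P₂, hβ, hδ, hx₂⟩

theorem exists_card_eq_two_pow_of_isTop (hodd : Odd (Fintype.card F)) (hF : 4 ≤ Fintype.card F)
    (h2 : (2 : F) ≠ 0) {x : SpU F} (hx : IsTopTwoSubgroup x P) :
    ∃ n, 4 ≤ n ∧ (Fintype.card F = 2 ^ n + 1 ∨ Fintype.card F + 1 = 2 ^ n) := by
  obtain ⟨α, β, γ, δ, h, h', P', hβ, hδ, hx'⟩ := exists_isTop_diagU_rotS hodd hF h2 hx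
  have : Fact (Nat.Prime 2) := ⟨Nat.prime_two⟩
  obtain ⟨n, hn⟩ := IsPGroup.iff_card.mp (isPGroup_rotations hodd h2 hx')
  have h8 := not_card_rotations_dvd_eight hodd h2 hβ hδ hx'
  have hc := card_rotations h2 (F := F)
  rw [hn] at h8 hc
  refine ⟨n, ?_, ?_⟩
  · by_contra! hlt
    exact h8 (pow_dvd_pow 2 (Nat.le_of_lt_succ hlt) : 2 ^ n ∣ 2 ^ 3)
  · split_ifs at hc <;> omega

end Forward

section Wreath

/-- The subgroup of `SL₂(F)` consisting of all rotations and reflections. -/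
def dihedral (F : Type*) [Field F] : Subgroup (SLTwo F) where
  carrier := {a | a ∈ rotations F ∨ ∃ p r h, a = reflS p r h}
  one_mem' := Or.inl (one_mem _)
  mul_mem' := by
    rintro _ _ (⟨α, β, h, rfl⟩ | ⟨p, r, h, rfl⟩) (⟨γ, δ, h', rfl⟩ | ⟨p', r', h', rfl⟩)
    · exact Or.inl (mul_mem rotS_mem rotS_mem)
    · exact Or.inr ⟨_, _, by linear_combination (α ^ 2 + β ^ 2) * h' - h,
        Subtype.ext (rot_mul_refl ..)⟩
    · exact Or.inr ⟨_, _, by linear_combination (γ ^ 2 + δ ^ 2) * h - h',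
        Subtype.ext (refl_mul_rot ..)⟩
    · exact Or.inl ⟨_, _, by linear_combination (p ^ 2 + r ^ 2) * h' - h,
        Subtype.ext (refl_mul_refl ..)⟩
  inv_mem' := by
    rintro _ (h | ⟨p, r, h, rfl⟩)
    · exact Or.inl (inv_mem h)
    · refine Or.inr ⟨-p, -r, by linear_combination h, Subtype.ext ?_⟩
      rw [coe_inv_eq, coe_reflS, trace_refl, zero_smul, zero_sub]
      ext i j
      fin_cases i <;> fin_cases j <;> simp [refl]

theorem rotS_mem_dihedral {α β : F} {h : α ^ 2 + β ^ 2 = 1} : rotS α β h ∈ dihedral F :=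
  Or.inl rotS_mem

theorem isPGroup_dihedral (h : IsPGroup 2 (rotations F)) : IsPGroup 2 (dihedral F) := by
  rintro ⟨a, ha | ⟨p, r, h, rfl⟩⟩
  · obtain ⟨k, hk⟩ := h.exists_pow_eq_one ha
    exact ⟨k, Subtype.ext hk⟩
  · exact ⟨2, Subtype.ext (pow_four_eq_one_of_sq_eq_neg_one (reflS_sq (h := h)))⟩

/-- The wreath product of `N` with the cyclic group of order two, as a subgroup of `Sp₄(F)`. -/
def wreath (N : Subgroup (SLTwo F)) : Subgroup (SpU F) where
  carrier := {y | ∃ a ∈ N, ∃ b ∈ N, y = diagU a b ∨ y = antiU a b}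
  one_mem' := ⟨1, one_mem N, 1, one_mem N, Or.inl diagU_one_one.symm⟩
  mul_mem' := by
    rintro _ _ ⟨a, ha, b, hb, rfl | rfl⟩ ⟨c, hc, d, hd, rfl | rfl⟩
    · exact ⟨_, mul_mem ha hc, _, mul_mem hb hd, Or.inl (by simp)⟩
    · exact ⟨_, mul_mem ha hc, _, mul_mem hb hd, Or.inr (by simp)⟩
    · exact ⟨_, mul_mem ha hd, _, mul_mem hb hc, Or.inr (by simp)⟩
    · exact ⟨_, mul_mem ha hd, _, mul_mem hb hc, Or.inl (by simp)⟩
  inv_mem' := by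
    rintro _ ⟨a, ha, b, hb, rfl | rfl⟩
    · exact ⟨_, inv_mem ha, _, inv_mem hb, Or.inl (by simp)⟩
    · exact ⟨_, inv_mem hb, _, inv_mem ha, Or.inr (by simp)⟩

variable {N : Subgroup (SLTwo F)}

theorem isPGroup_wreath (hN : IsPGroup 2 N) : IsPGroup 2 (wreath N) := by
  have key {a b : SLTwo F} (ha : a ∈ N) (hb : b ∈ N) : ∃ k, diagU a b ^ 2 ^ k = 1 := by
    obtain ⟨k, hk⟩ := hN.exists_pow_eq_one ha
    obtain ⟨l, hl⟩ := hN.exists_pow_eq_one hb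
    refine ⟨k + l, ?_⟩
    rw [diagU_pow, diagU_eq_one, pow_add 2, pow_mul, hk, one_pow, mul_comm, pow_mul, hl, one_pow]
    exact ⟨rfl, rfl⟩
  rintro ⟨_, a, ha, b, hb, rfl | rfl⟩
  · obtain ⟨k, hk⟩ := key ha hb
    exact ⟨k, Subtype.ext hk⟩
  · obtain ⟨k, hk⟩ := key (mul_mem ha hb) (mul_mem hb ha)
    refine ⟨k + 1, Subtype.ext ?_⟩
    change antiU a b ^ 2 ^ (k + 1) = 1
    rw [pow_succ', pow_mul, pow_two, antiU_mul_antiU, hk]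

theorem eq_zero_or_trace_eq {A : Mat F} {s a : SLTwo F} (h : A * a = s * A) :
    A = 0 ∨ (s : Mat F).trace = (a : Mat F).trace := by
  by_contra! hne
  have h1 : A * ((a : Mat F) * a) = (s : Mat F) * s * A := by
    rw [← mul_assoc, h, mul_assoc, h, mul_assoc]
  rw [mul_self_eq, mul_self_eq, mul_sub, sub_mul, mul_one, one_mul, sub_left_inj, mul_smul_comm,
    smul_mul_assoc, ← h, ← sub_eq_zero, ← sub_smul] at h1
  have h2 := (smul_eq_zero.mp h1).resolve_left (sub_ne_zero.mpr hne.2.symm)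
  refine hne.1 ?_
  have h3 := congrArg (· * ((a⁻¹ : SLTwo F) : Mat F)) h2
  simpa [mul_assoc, ← Submonoid.coe_mul] using h3

theorem mem_dihedral_of_conj_mem (h2 : (2 : F) ≠ 0) {g : SLTwo F} {α β : F}
    {h : α ^ 2 + β ^ 2 = 1} (hα : α ≠ 0) (hβ : β ≠ 0)
    (hg : g * rotS α β h * g⁻¹ ∈ dihedral F) : g ∈ dihedral F := by
  have ht := trace_conj g (rotS α β h)
  rcases hg with ⟨γ, δ, h', hg⟩ | ⟨p, r, h', hg⟩ <;> rw [hg] at ht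
  · rw [coe_rotS, coe_rotS, trace_rot, trace_rot] at ht
    obtain rfl := mul_left_cancel₀ h2 ht
    rw [mul_inv_eq_iff_eq_mul] at hg
    have hg' := congrArg Subtype.val hg
    have hd := det_coe g
    obtain ⟨g, hgS⟩ := g
    simp only [Submonoid.coe_mul, coe_rotS] at hg' hd
    have e00 := congrFun (congrFun hg' 0) 0
    have e01 := congrFun (congrFun hg' 0) 1
    simp only [rot, Matrix.mul_apply, Fin.sum_univ_two, Matrix.of_apply, Matrix.cons_val',
      Matrix.cons_val_zero, Matrix.cons_val_one] at e00 e01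
    rw [Matrix.det_fin_two] at hd
    have hδ : δ ^ 2 = β ^ 2 := by linear_combination h' - h
    rcases sq_eq_sq_iff_eq_or_eq_neg.mp hδ with rfl | rfl
    · have h1 : g 0 1 = -g 1 0 := mul_left_cancel₀ hβ (by linear_combination e00)
      have h3 : g 1 1 = g 0 0 := mul_left_cancel₀ hβ (by linear_combination e01)
      refine Or.inl ⟨g 0 0, g 1 0, by rw [h1, h3] at hd; linear_combination hd, Subtype.ext ?_⟩
      ext i j
      fin_cases i <;> fin_cases j <;> simp [rot, h1, h3]
    · have h1 : g 0 1 = g 1 0 := mul_left_cancel₀ hβ (by linear_combination e00)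
      have h3 : g 1 1 = -g 0 0 := mul_left_cancel₀ hβ (by linear_combination -e01)
      refine Or.inr ⟨g 0 0, g 1 0, by rw [h1, h3] at hd; linear_combination -hd, Subtype.ext ?_⟩
      ext i j
      fin_cases i <;> fin_cases j <;> simp [refl, h1, h3]
  · rw [coe_rotS, coe_reflS, trace_rot, trace_refl] at ht
    exact absurd ht.symm (mul_ne_zero h2 hα)

theorem trace_block_mul_comm (M M' : Matrix (Fin 2) (Fin 2) (Mat F)) :
    ((M * M') 0 0).trace + ((M * M') 1 1).trace =
      ((M' * M) 0 0).trace + ((M' * M) 1 1).trace := by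
  simp only [Matrix.mul_apply, Fin.sum_univ_two, Matrix.trace_add]
  rw [Matrix.trace_mul_comm (M 0 0), Matrix.trace_mul_comm (M 0 1), Matrix.trace_mul_comm (M 1 0),
    Matrix.trace_mul_comm (M 1 1)]
  ring

theorem trace_block_conj (y x : SpU F) :
    ((y * x * y⁻¹).1 0 0).trace + ((y * x * y⁻¹).1 1 1).trace =
      (x.1 0 0).trace + (x.1 1 1).trace := by
  rw [Submonoid.coe_mul, trace_block_mul_comm, ← Submonoid.coe_mul, inv_mul_cancel_left]

theorem mem_monomial_of_eq_zero {y : SpU F} (h1 : y.1 0 0 = 0 ∨ y.1 0 1 = 0)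
    (h2 : y.1 1 0 = 0 ∨ y.1 1 1 = 0) : y ∈ monomial F := by
  have hy := mem_SpU_iff.mp y.2
  rw [Matrix.eta_fin_two y.1, star_block, Matrix.mul_fin_two, one_block] at hy
  have h00 : y.1 0 0 * star (y.1 0 0) + y.1 0 1 * star (y.1 0 1) = 1 := by
    simpa using congrFun (congrFun hy 0) 0
  have h01 : y.1 0 0 * star (y.1 1 0) + y.1 0 1 * star (y.1 1 1) = 0 := by
    simpa using congrFun (congrFun hy 0) 1
  have h11 : y.1 1 0 * star (y.1 1 0) + y.1 1 1 * star (y.1 1 1) = 1 := by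
    simpa using congrFun (congrFun hy 1) 1
  rcases h1 with h1 | h1 <;> rcases h2 with h2 | h2
  · rw [h1, zero_mul, zero_add] at h00 h01
    rw [h2, zero_mul, zero_add] at h11
    have h := congrArg (· * y.1 1 1) (congrArg (star (y.1 0 1) * ·) h01)
    rw [mul_eq_one_comm] at h00 h11
    simp only [← mul_assoc, h00, mul_zero, zero_mul, one_mul, h11] at h
    exact absurd h one_ne_zero
  · obtain ⟨a, b, h⟩ := exists_eq_antiU h1 h2
    exact ⟨a, b, Or.inr h⟩
  · obtain ⟨a, b, h⟩ := exists_eq_diagU h1 h2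
    exact ⟨a, b, Or.inl h⟩
  · rw [h1, zero_mul, add_zero] at h00 h01
    rw [h2, zero_mul, add_zero] at h11
    have h := congrArg (· * y.1 1 0) (congrArg (star (y.1 0 0) * ·) h01)
    rw [mul_eq_one_comm] at h00 h11
    simp only [← mul_assoc, h00, mul_zero, zero_mul, one_mul, h11] at h
    exact absurd h one_ne_zero

variable {α β γ δ : F} {h : α ^ 2 + β ^ 2 = 1} {h' : γ ^ 2 + δ ^ 2 = 1}

theorem mem_wreath_of_conj_mem (h2 : (2 : F) ≠ 0) (hα : α ≠ 0) (hβ : β ≠ 0) (hγ : γ ≠ 0)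
    (hδ : δ ≠ 0) (hne : α ≠ γ) (hne' : α ≠ -γ) {y : SpU F}
    (hy : y * diagU (rotS α β h) (rotS γ δ h') * y⁻¹ ∈ wreath (dihedral F)) :
    y ∈ wreath (dihedral F) := by
  have ht := trace_block_conj y (diagU (rotS α β h) (rotS γ δ h'))
  obtain ⟨s, hs, t, ht', hst | hst⟩ := hy
  · have hmul := congrArg Subtype.val (mul_inv_eq_iff_eq_mul.mp hst)
    rw [coe_mul_diagU, coe_diagU_mul] at hmul
    have hrow {A B : Mat F} {s : SLTwo F} (hA : A * (rotS α β h : SLTwo F) = s * A)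
        (hB : B * (rotS γ δ h' : SLTwo F) = s * B) : A = 0 ∨ B = 0 := by
      by_contra! h0
      have hA' := (eq_zero_or_trace_eq hA).resolve_left h0.1
      have hB' := (eq_zero_or_trace_eq hB).resolve_left h0.2
      rw [hA', coe_rotS, coe_rotS, trace_rot, trace_rot] at hB'
      exact hne (mul_left_cancel₀ h2 hB')
    obtain ⟨a, b, rfl | rfl⟩ := mem_monomial_of_eq_zero (y := y)
      (hrow (congrFun (congrFun hmul 0) 0) (congrFun (congrFun hmul 0) 1))
      (hrow (congrFun (congrFun hmul 1) 0) (congrFun (congrFun hmul 1) 1))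
    · rw [diagU_mul_diagU, diagU_inv, diagU_mul_diagU, diagU_inj] at hst
      exact ⟨a, mem_dihedral_of_conj_mem h2 hα hβ (hst.1 ▸ hs),
        b, mem_dihedral_of_conj_mem h2 hγ hδ (hst.2 ▸ ht'), Or.inl rfl⟩
    · rw [antiU_mul_diagU, antiU_inv, antiU_mul_antiU, diagU_inj] at hst
      exact ⟨a, mem_dihedral_of_conj_mem h2 hγ hδ (hst.1 ▸ hs),
        b, mem_dihedral_of_conj_mem h2 hα hβ (hst.2 ▸ ht'), Or.inr rfl⟩
  · rw [hst] at ht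
    have h0 : 2 * (α + γ) = 0 := by simpa [mul_add, eq_comm] using ht
    exact absurd (eq_neg_of_add_eq_zero_left ((mul_eq_zero.mp h0).resolve_left h2)) hne'

theorem exists_rotS_of_card_lt [Finite F] (T : Finset F)
    (hT : 2 * T.card < Nat.card (rotations F)) :
    ∃ (α β : F), α ^ 2 + β ^ 2 = 1 ∧ α ∉ T := by
  classical
  by_contra! hc
  have := Fintype.ofFinite (rotations F)
  refine hT.not_ge ?_
  rw [Nat.card_eq_fintype_card, ← Finset.card_univ]
  refine Finset.card_le_mul_card_image_of_maps_to (f := fun a : rotations F => a.1.1 0 0) ?_ 2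
    fun t _ => ?_
  · rintro ⟨_, α, β, h, rfl⟩ -
    exact hc α β h
  · rcases Finset.eq_empty_or_nonempty
      (Finset.univ.filter fun a : rotations F => a.1.1 0 0 = t) with h0 | ⟨a, ha⟩
    · rw [h0]
      simp
    · refine (Finset.card_le_card (t := {a, a⁻¹}) fun b hb => ?_).trans Finset.card_le_two
      obtain ⟨_, α, β, h, rfl⟩ := a
      obtain ⟨_, γ, δ, h', rfl⟩ := b
      have ha' : α = t := (Finset.mem_filter.mp ha).2
      have hb' : γ = t := (Finset.mem_filter.mp hb).2
      obtain rfl : γ = α := hb'.trans ha'.symm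
      have hδ : δ ^ 2 = β ^ 2 := by linear_combination h' - h
      rw [Finset.mem_insert, Finset.mem_singleton]
      rcases sq_eq_sq_iff_eq_or_eq_neg.mp hδ with rfl | rfl
      · exact Or.inl rfl
      · exact Or.inr (Subtype.ext (Subtype.ext (star_rot ..).symm))

theorem exists_isTop_of_card_rotations [Finite F] (h2 : (2 : F) ≠ 0) {n : ℕ} (hn : 4 ≤ n)
    (hc : Nat.card (rotations F) = 2 ^ n) :
    ∃ (x : SpU F) (P : Subgroup (SpU F)), IsTopTwoSubgroup x P := by
  classical
  have hn16 : 2 ^ 4 ≤ Nat.card (rotations F) := hc ▸ Nat.pow_le_pow_right two_pos hn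
  obtain ⟨α, β, h, hα⟩ := exists_rotS_of_card_lt ({0, 1, -1} : Finset F) (by
    have := Finset.card_le_three (a := (0 : F)) (b := 1) (c := -1)
    omega)
  obtain ⟨γ, δ, h', hγ⟩ := exists_rotS_of_card_lt ({0, 1, -1, α, -α} : Finset F) (by
    have := Finset.card_le_five (a := (0 : F)) (b := 1) (c := -1) (d := α) (e := -α)
    omega)
  simp only [Finset.mem_insert, Finset.mem_singleton, not_or] at hα hγ
  have hβ : β ≠ 0 := by
    rintro rfl
    exact (sq_eq_sq_iff_eq_or_eq_neg.mp
      (by linear_combination h : α ^ 2 = 1 ^ 2)).elim hα.2.1 hα.2.2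
  have hδ : δ ≠ 0 := by
    rintro rfl
    exact (sq_eq_sq_iff_eq_or_eq_neg.mp
      (by linear_combination h' : γ ^ 2 = 1 ^ 2)).elim hγ.2.1 hγ.2.2.1
  refine ⟨diagU (rotS α β h) (rotS γ δ h'), wreath (dihedral F),
    isTopTwoSubgroup_of_forall_conj_mem (isPGroup_wreath (isPGroup_dihedral (IsPGroup.of_card hc)))
      ⟨_, rotS_mem_dihedral, _, rotS_mem_dihedral, Or.inl rfl⟩ fun y _ _ hy =>
      mem_wreath_of_conj_mem h2 hα.1 hβ hγ.1 hδ (Ne.symm hγ.2.2.2.1) ?_ hy⟩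
  rintro rfl
  exact hγ.2.2.2.2 (neg_neg γ).symm

theorem card_rotations_eq_two_pow [Fintype F] (h2 : (2 : F) ≠ 0) {n : ℕ} (hn : 2 ≤ n)
    (hc : Fintype.card F = 2 ^ n + 1 ∨ Fintype.card F + 1 = 2 ^ n) :
    Nat.card (rotations F) = 2 ^ n := by
  have hr := card_rotations h2 (F := F)
  obtain ⟨m, rfl⟩ : ∃ m, n = m + 2 := ⟨n - 2, by omega⟩
  rw [pow_add] at hc ⊢
  have hsq := FiniteField.isSquare_neg_one_iff (F := F)
  split_ifs at hr with h <;> rw [hsq] at h <;> omega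

end Wreath

section CardThree

theorem eq_zero_or_one_or_neg_one [Fintype F] (hF : Fintype.card F = 3) (t : F) :
    t = 0 ∨ t = 1 ∨ t = -1 := by
  have h := FiniteField.pow_card t
  rw [hF] at h
  have h' : t * ((t - 1) * (t + 1)) = 0 := by linear_combination h
  simpa only [mul_eq_zero, sub_eq_zero, add_eq_zero_iff_eq_neg] using h'

theorem three_eq_zero [Fintype F] (hF : Fintype.card F = 3) : (3 : F) = 0 := by
  have h := FiniteField.cast_card_eq_zero F
  rw [hF] at h
  exact_mod_cast h

theorem eq_zero_of_sq_add_sq_eq_zero [Fintype F] (hF : Fintype.card F = 3) {u v : F}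
    (h : u ^ 2 + v ^ 2 = 0) : u = 0 ∧ v = 0 := by
  have h3 := three_eq_zero hF
  rcases eq_zero_or_one_or_neg_one hF u with rfl | rfl | rfl <;>
    rcases eq_zero_or_one_or_neg_one hF v with rfl | rfl | rfl <;>
    first
    | exact ⟨rfl, rfl⟩
    | exact absurd (by linear_combination h : (1 : F) = 0) one_ne_zero
    | exact absurd (by linear_combination h3 - h : (1 : F) = 0) one_ne_zero

theorem mem_dihedral_of_trace_eq_zero [Fintype F] (hF : Fintype.card F = 3) {g : SLTwo F}
    (hg : (g : Mat F).trace = 0) : g ∈ dihedral F := by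
  have h3 := three_eq_zero hF
  have hd := det_coe g
  obtain ⟨g, hgS⟩ := g
  change g.trace = 0 at hg
  change g.det = 1 at hd
  rw [Matrix.trace_fin_two] at hg
  rw [Matrix.det_fin_two] at hd
  have h11 : g 1 1 = -g 0 0 := by linear_combination hg
  by_cases hs : g 0 1 = -g 1 0
  · rw [h11, hs] at hd
    have h0 : g 0 0 = 0 := by
      by_contra h0
      rcases eq_zero_or_one_or_neg_one hF (g 0 0) with h | h | h <;>
        rcases eq_zero_or_one_or_neg_one hF (g 1 0) with h' | h' | h' <;> rw [h, h'] at hd <;>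
        first
        | exact h0 h
        | exact one_ne_zero (by linear_combination -hd : (1 : F) = 0)
        | exact one_ne_zero (by linear_combination h3 + hd : (1 : F) = 0)
    refine Or.inl ⟨0, g 1 0, by rw [h0] at hd; linear_combination hd, Subtype.ext ?_⟩
    ext i j
    fin_cases i <;> fin_cases j <;> simp [rot, h0, h11, hs]
  · have hs' : g 0 1 = g 1 0 := by
      rw [h11] at hd
      rcases eq_zero_or_one_or_neg_one hF (g 0 0) with h | h | h <;>
        rcases eq_zero_or_one_or_neg_one hF (g 1 0) with h' | h' | h' <;>
        rcases eq_zero_or_one_or_neg_one hF (g 0 1) with h'' | h'' | h'' <;>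
        rw [h, h', h''] at hd <;> rw [h', h''] at hs ⊢ <;>
        first
        | rfl
        | exact absurd (by ring1) hs
        | exact absurd (by linear_combination -hd : (1 : F) = 0) one_ne_zero
        | exact absurd (by linear_combination h3 + hd : (1 : F) = 0) one_ne_zero
    refine Or.inr ⟨g 0 0, g 1 0, by rw [h11, hs'] at hd; linear_combination -hd,
      Subtype.ext ?_⟩
    ext i j
    fin_cases i <;> fin_cases j <;> simp [refl, h11, hs']

theorem neg_one_mem_dihedral : (-1 : SLTwo F) ∈ dihedral F :=
  Or.inl ⟨-1, 0, by simp, Subtype.ext (by rw [coe_rotS, ← neg_zero, ← neg_rot, rot_one_zero]; rfl)⟩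

theorem pow_three_mem_dihedral [Fintype F] (hF : Fintype.card F = 3) (g : SLTwo F) :
    g ^ 3 ∈ dihedral F := by
  have hg : ((g ^ 3 : SLTwo F) : Mat F) =
      ((g : Mat F).trace ^ 2 - 1) • (g : Mat F) - (g : Mat F).trace • 1 := by
    rw [pow_succ, pow_two, Submonoid.coe_mul, Submonoid.coe_mul, mul_self_eq, sub_mul,
      smul_mul_assoc, mul_self_eq, one_mul, smul_sub, smul_smul, sub_smul, one_smul, pow_two]
    abel
  rcases eq_zero_or_one_or_neg_one hF (g : Mat F).trace with h | h | h
  · exact pow_mem (mem_dihedral_of_trace_eq_zero hF h) 3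
  · rw [h, one_pow, sub_self, zero_smul, zero_sub, one_smul] at hg
    rw [show g ^ 3 = -1 from Subtype.ext hg]
    exact neg_one_mem_dihedral
  · rw [h, neg_one_sq, sub_self, zero_smul, zero_sub, neg_smul, one_smul, neg_neg] at hg
    rw [show g ^ 3 = 1 from Subtype.ext hg]
    exact one_mem _

theorem eq_zero_of_mul_rot_eq [Fintype F] (hF : Fintype.card F = 3) {A m : Mat F}
    (hA : A * rot 0 1 = m * A) (hd : A.det = 0) : A = 0 := by
  have e00 := congrFun (congrFun hA 0) 0
  have e01 := congrFun (congrFun hA 0) 1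
  have e10 := congrFun (congrFun hA 1) 0
  have e11 := congrFun (congrFun hA 1) 1
  simp only [rot, Matrix.mul_apply, Fin.sum_univ_two, Matrix.of_apply, Matrix.cons_val',
    Matrix.cons_val_zero, Matrix.cons_val_one] at e00 e01 e10 e11
  rw [Matrix.det_fin_two] at hd
  obtain ⟨h00, h01⟩ := eq_zero_of_sq_add_sq_eq_zero hF (u := A 0 0) (v := A 0 1)
    (by linear_combination A 0 1 * e00 - A 0 0 * e01 - m 0 1 * hd)
  obtain ⟨h10, h11⟩ := eq_zero_of_sq_add_sq_eq_zero hF (u := A 1 0) (v := A 1 1)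
    (by linear_combination A 1 1 * e10 - A 1 0 * e11 + m 1 0 * hd)
  ext i j
  fin_cases i <;> fin_cases j <;> simpa

theorem exists_eq_rot_of_commute {K : Mat F} (hK : K * rot 0 1 = rot 0 1 * K) :
    ∃ u v, K = rot u v := by
  have e00 := congrFun (congrFun hK 0) 0
  have e01 := congrFun (congrFun hK 0) 1
  simp only [rot, Matrix.mul_apply, Fin.sum_univ_two, Matrix.of_apply, Matrix.cons_val',
    Matrix.cons_val_zero, Matrix.cons_val_one] at e00 e01
  have h01 : K 0 1 = -K 1 0 := by linear_combination e00
  have h11 : K 1 1 = K 0 0 := by linear_combination e01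
  refine ⟨K 0 0, K 1 0, ?_⟩
  ext i j
  fin_cases i <;> fin_cases j <;> simp [rot, h01, h11]

theorem eq_zero_or_eq_zero_of_mul_rot_eq [Fintype F] (hF : Fintype.card F = 3) {A C : Mat F}
    {m : SLTwo F} (hm : m ^ 2 = -1) (hA : A * rot 0 1 = (m : Mat F) * A)
    (hC : C * rot 0 1 = (m : Mat F) * C)
    (h1 : A * star A + m * C * star (m * C) = 1) (h0 : A * star C + m * C * star A = 0) :
    A = 0 ∨ C = 0 := by
  have h3 := three_eq_zero hF
  have hmstar : star (m : Mat F) = -m := by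
    have : m⁻¹ = -m := by rw [inv_eq_iff_mul_eq_one, mul_neg, ← pow_two, hm, neg_neg]
    exact congrArg Subtype.val this
  have hdet : A.det + C.det = 1 := by
    rw [mul_star_eq, mul_star_eq, Matrix.det_mul, det_coe, one_mul, ← add_smul] at h1
    simpa using congrFun (congrFun h1 0) 0
  have hAm : star A * (m : Mat F) = (rot 0 1 : Mat F) * star A := by
    have := congrArg star hA
    rw [star_mul, star_mul, hmstar, star_rot, mul_neg, ← neg_eq_iff_eq_neg, ← neg_mul, neg_rot,
      neg_zero, neg_neg] at this
    exact this.symm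
  obtain ⟨u, v, hK⟩ := exists_eq_rot_of_commute (K := star A * C)
    (by rw [mul_assoc, hC, ← mul_assoc, hAm, mul_assoc])
  have hKs : star C * A = rot u (-v) := by
    rw [← star_rot, ← hK, star_mul, star_star]
  have hKd : A.det * C.det = u ^ 2 + v ^ 2 := by
    rw [← det_rot, ← hK, Matrix.det_mul, star_eq_adjugate, Matrix.det_adjugate]
    simp
  have hsum : A.det • (rot u (-v) + rot 0 1 * rot u v) = 0 := by
    have h := congrArg (fun X => star A * X * A) h0
    simp only [mul_add, add_mul, mul_zero, zero_mul] at h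
    rw [← h, ← hKs, ← hK, smul_add]
    congr 1
    · rw [← mul_assoc (star A), star_mul_eq, smul_mul_assoc, one_mul, smul_mul_assoc]
    · rw [← mul_assoc (star A), ← mul_assoc (star A), hAm, mul_assoc _ (star A) A, star_mul_eq,
        mul_smul_comm, mul_one, mul_assoc]
  rcases eq_zero_or_one_or_neg_one hF C.det with h | h | h
  · exact Or.inr (eq_zero_of_mul_rot_eq hF hC h)
  · exact Or.inl (eq_zero_of_mul_rot_eq hF hA (by linear_combination hdet - h))
  · have hAd : A.det = -1 := by linear_combination hdet - h + h3
    rw [rot_mul_rot, rot_add_rot, smul_rot, ← rot_zero_zero, rot_inj, hAd] at hsum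
    rw [hAd, h] at hKd
    have huv : u = v := by linear_combination -hsum.1
    rw [huv] at hKd
    obtain ⟨hv, -⟩ := eq_zero_of_sq_add_sq_eq_zero hF (u := 1) (v := v)
      (by linear_combination v ^ 2 * h3 + hKd)
    exact absurd hv one_ne_zero

theorem mem_monomial_of_mul_antiU_eq [Fintype F] (hF : Fintype.card F = 3) {y : SpU F}
    {m : SLTwo F} (hm : m ^ 2 = -1)
    (hy : y * antiU (rotS 0 1 (by simp)) 1 = antiU m 1 * y) : y ∈ monomial F := by
  have hmul := congrArg Subtype.val hy
  have hys := mem_SpU_iff.mp y.2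
  simp only [Submonoid.coe_mul, coe_antiU, coe_rotS, OneMemClass.coe_one] at hmul
  rw [Matrix.eta_fin_two y.1, star_block, Matrix.mul_fin_two, one_block] at hys
  rw [Matrix.eta_fin_two y.1, Matrix.mul_fin_two, Matrix.mul_fin_two] at hmul
  have h00 : y.1 0 1 = (m : Mat F) * y.1 1 0 := by simpa using congrFun (congrFun hmul 0) 0
  have h01 : y.1 0 0 * rot 0 1 = (m : Mat F) * y.1 1 1 := by
    simpa using congrFun (congrFun hmul 0) 1
  have h10 : y.1 1 1 = y.1 0 0 := by simpa using congrFun (congrFun hmul 1) 0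
  have h11 : y.1 1 0 * rot 0 1 = y.1 0 1 := by simpa using congrFun (congrFun hmul 1) 1
  have hs00 : y.1 0 0 * star (y.1 0 0) + y.1 0 1 * star (y.1 0 1) = 1 := by
    simpa using congrFun (congrFun hys 0) 0
  have hs01 : y.1 0 0 * star (y.1 1 0) + y.1 0 1 * star (y.1 1 1) = 0 := by
    simpa using congrFun (congrFun hys 0) 1
  rw [h10] at h01 hs01
  rw [h00] at h11 hs00 hs01
  rcases eq_zero_or_eq_zero_of_mul_rot_eq hF hm h01 h11 hs00 hs01 with h | h
  · exact mem_monomial_of_eq_zero (Or.inl h) (Or.inr (h10.trans h))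
  · exact mem_monomial_of_eq_zero (Or.inr (by rw [h00, h, mul_zero])) (Or.inl h)

theorem pow_four_eq_one_of_mem_dihedral [Fintype F] (hF : Fintype.card F = 3) (h2 : (2 : F) ≠ 0)
    {s : SLTwo F} (hs : s ∈ dihedral F) : s ^ 4 = 1 := by
  rcases hs with hs | ⟨p, r, h, rfl⟩
  · have hc : Nat.card (rotations F) = 2 ^ 2 :=
      card_rotations_eq_two_pow h2 le_rfl (Or.inr (by rw [hF]; rfl))
    have h1 : (⟨s, hs⟩ : rotations F) ^ Nat.card (rotations F) = 1 := pow_card_eq_one'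
    rw [hc] at h1
    exact congrArg Subtype.val h1
  · exact pow_four_eq_one_of_sq_eq_neg_one reflS_sq

theorem left_mem_of_antiU_mem_wreath {N : Subgroup (SLTwo F)} {a b : SLTwo F}
    (h : antiU a b ∈ wreath N) : a ∈ N := by
  obtain ⟨s, hs, t, -, hst | hst⟩ := h
  · have h0 : (a : Mat F) = 0 := congrFun (congrFun (congrArg Subtype.val hst) 0) 1
    have hd := det_coe a
    rw [h0, Matrix.det_zero] at hd
    exact absurd hd zero_ne_one
  · have h0 : (a : Mat F) = s := congrFun (congrFun (congrArg Subtype.val hst) 0) 1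
    rwa [Subtype.ext h0]

theorem mem_monomial_of_conj_mem_wreath [Fintype F] (hF : Fintype.card F = 3) (h2 : (2 : F) ≠ 0)
    {y : SpU F} (hy : y * antiU (rotS 0 1 (by simp)) 1 * y⁻¹ ∈ wreath (dihedral F)) :
    y ∈ monomial F := by
  have hj : (rotS 0 1 (by simp) : SLTwo F) ^ 2 = -1 := sq_eq_neg_one_of_trace_eq_zero (by simp)
  have hneg : diagU (-1 : SLTwo F) (-1) = -1 := by simpa using diagU_neg_one_mul (1 : SpU F)
  have hx4 : (y * antiU (rotS 0 1 (by simp)) 1 * y⁻¹) ^ (2 * 2) = -1 := by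
    rw [conj_pow, pow_mul, pow_two (antiU _ _), antiU_mul_antiU, one_mul, mul_one, diagU_pow, hj,
      hneg, mul_neg, neg_mul, mul_one, mul_inv_cancel]
  obtain ⟨s, hs, t, ht, hst | hst⟩ := hy
  · rw [hst, diagU_pow, pow_four_eq_one_of_mem_dihedral hF h2 hs,
      pow_four_eq_one_of_mem_dihedral hF h2 ht, ← hneg, diagU_inj] at hx4
    have := congrFun (congrFun (congrArg Subtype.val hx4.1) 0) 0
    simp only [coe_neg_one, OneMemClass.coe_one, Matrix.neg_apply, Matrix.one_apply_eq] at this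
    exact absurd (by linear_combination this) h2
  · rw [hst, pow_mul, pow_two (antiU _ _), antiU_mul_antiU, diagU_pow, ← hneg, diagU_inj] at hx4
    have hu : diagU 1 t⁻¹ ∈ monomial F := ⟨_, _, Or.inl rfl⟩
    refine (Subgroup.mul_mem_cancel_left _ hu).mp (mem_monomial_of_mul_antiU_eq hF hx4.1 ?_)
    rw [mul_assoc, mul_inv_eq_iff_eq_mul.mp hst, ← mul_assoc, ← mul_assoc]
    simp

theorem exists_isTop_of_card_eq_three [Fintype F] (hF : Fintype.card F = 3) (h2 : (2 : F) ≠ 0) :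
    ∃ (x : SpU F) (P : Subgroup (SpU F)), IsTopTwoSubgroup x P := by
  have hc : Nat.card (rotations F) = 2 ^ 2 :=
    card_rotations_eq_two_pow h2 le_rfl (Or.inr (by rw [hF]; rfl))
  refine ⟨antiU (rotS 0 1 (by simp)) 1, wreath (dihedral F),
    isTopTwoSubgroup_of_forall_conj_mem (isPGroup_wreath (isPGroup_dihedral (IsPGroup.of_card hc)))
      ⟨_, rotS_mem_dihedral, _, one_mem _, Or.inr rfl⟩ fun y k hyk hy => ?_⟩
  have h3 (g : SLTwo F) : g ^ 3 ∈ dihedral F := pow_three_mem_dihedral hF g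
  obtain ⟨a, b, rfl | rfl⟩ := mem_monomial_of_conj_mem_wreath hF h2 hy
  · obtain ⟨n, hn⟩ := exists_pow_three_pow_eq_self hyk
    rw [← hn, diagU_pow]
    exact pow_mem (show _ ∈ wreath (dihedral F) from ⟨_, h3 a, _, h3 b, Or.inl rfl⟩) n
  · rw [antiU_mul_antiU, antiU_inv, diagU_mul_antiU, mul_one] at hy
    have hab := left_mem_of_antiU_mem_wreath hy
    have hab' : a * b ∈ dihedral F := by
      have h1 : (a * b) ^ 2 ^ k = 1 := by
        have h := congrArg (· ^ 2) hyk
        simp only [← pow_mul, mul_comm _ 2, one_pow] at h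
        rw [pow_mul, pow_two, antiU_mul_antiU, diagU_pow, diagU_eq_one] at h
        exact h.1
      obtain ⟨n, hn⟩ := exists_pow_three_pow_eq_self h1
      rw [← hn]
      exact pow_mem (h3 _) n
    have hb2 : b ^ 2 ∈ dihedral F := by
      have := mul_mem (inv_mem hab) hab'
      rwa [_root_.mul_inv_rev, inv_inv, mul_assoc, inv_mul_cancel_left, ← pow_two] at this
    have hb : b ∈ dihedral F := by
      have := mul_mem (h3 b) (inv_mem hb2)
      rwa [pow_succ', mul_inv_cancel_right] at this
    refine ⟨a, ?_, b, hb, Or.inr rfl⟩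
    have := mul_mem hab hb
    rwa [inv_mul_cancel_right] at this

end CardThree

section Main

theorem two_pow_cases {q : ℕ} (hodd : Odd q) (h5 : q ≠ 5) (h7 : q ≠ 7)
    (h : IsFermatPrime q ∨ IsMersennePrime q) :
    q = 3 ∨ ∃ n, 4 ≤ n ∧ (q = 2 ^ n + 1 ∨ q + 1 = 2 ^ n) := by
  rcases h with ⟨hp, m, rfl⟩ | ⟨hp, m, rfl⟩
  · match m with
    | 0 | 2 | 3 => revert hodd h5 hp; norm_num +decide
    | 1 => exact Or.inl rfl
    | m + 4 => exact Or.inr ⟨m + 4, by omega, Or.inl rfl⟩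
  · match m with
    | 0 | 1 | 3 => revert h7 hp; norm_num +decide
    | 2 => exact Or.inl rfl
    | m + 4 => exact Or.inr ⟨m + 4, by omega, Or.inr (Nat.sub_add_cancel Nat.one_le_two_pow)⟩

theorem exists_isTop_iff [Fintype F] (hodd : Odd (Fintype.card F)) :
    (∃ (x : SpU F) (P : Subgroup (SpU F)), IsTopTwoSubgroup x P) ↔
      Fintype.card F ≠ 5 ∧ Fintype.card F ≠ 7 ∧
        (IsFermatPrime (Fintype.card F) ∨ IsMersennePrime (Fintype.card F)) := by
  have h2 : (2 : F) ≠ 0 := Ring.two_ne_zero fun h =>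
    Nat.not_even_iff_odd.mpr hodd (Nat.even_iff.mpr (FiniteField.even_card_iff_char_two.mp h))
  constructor
  · rintro ⟨x, P, hx⟩
    by_cases hF : 4 ≤ Fintype.card F
    · obtain ⟨n, hn, hc⟩ := exists_card_eq_two_pow_of_isTop hodd hF h2 hx
      have h16 : 2 ^ 4 ≤ 2 ^ n := Nat.pow_le_pow_right two_pos hn
      have hp : (Fintype.card F).Prime := IsPrimePow.prime_of_eq_two_pow
        (FiniteField.isPrimePow_card F) hodd (by omega) hc
      exact ⟨by omega, by omega,
        hc.imp (fun h => ⟨hp, n, h⟩) fun h => ⟨hp, n, (Nat.sub_eq_of_eq_add h.symm).symm⟩⟩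
    · have h3 : Fintype.card F = 3 := by
        have := Fintype.one_lt_card (α := F)
        obtain ⟨t, ht⟩ := hodd
        omega
      rw [h3]
      exact ⟨by decide, by decide, Or.inr ⟨Nat.prime_three, 2, rfl⟩⟩
  · rintro ⟨h5, h7, h⟩
    rcases two_pow_cases hodd h5 h7 h with h3 | ⟨n, hn, hc⟩
    · exact exists_isTop_of_card_eq_three h3 h2
    · exact exists_isTop_of_card_rotations h2 hn (card_rotations_eq_two_pow h2 (by omega) hc)

end Main
end SpFour

theorem exists_orderOf_and_existsUnique_sylow_two_iff {G : Type*} [Group G] :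
    (∃ x : G, (∃ k : ℕ, orderOf x = 2 ^ k) ∧ ∃! P : Sylow 2 G, x ∈ P) ↔
      ∃ (x : G) (P : Subgroup G), IsTopTwoSubgroup x P := by
  refine exists_congr fun x => ?_
  rw [existsUnique_sylow_two_iff, and_iff_right_of_imp]
  rintro ⟨P, hP⟩
  obtain ⟨k, hk⟩ := hP.isPGroup.exists_pow_eq_one hP.mem
  obtain ⟨m, -, hm⟩ := (Nat.dvd_prime_pow Nat.prime_two).mp (orderOf_dvd_of_pow_eq_one hk)
  exact ⟨m, hm⟩

theorem exists_isTopTwoSubgroup_congr {G H : Type*} [Group G] [Group H] (e : G ≃* H) :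
    (∃ (x : G) (P : Subgroup G), IsTopTwoSubgroup x P) ↔
      ∃ (x : H) (P : Subgroup H), IsTopTwoSubgroup x P :=
  ⟨fun ⟨_, _, h⟩ => ⟨_, _, h.map e⟩, fun ⟨_, _, h⟩ => ⟨_, _, h.map e.symm⟩⟩

/-- For `q` an odd prime power, `Sp_4(𝔽_q)` contains a picky `2`-element
if and only if `q ∉ {5, 7}` and `q` is a Fermat or Mersenne prime. -/
theorem picky_two_element_Sp4_iff
    (q : ℕ) (hq : IsPrimePow q) (hodd : Odd q)
    (F : Type*) [Field F] [Fintype F] [DecidableEq F] (hF : Fintype.card F = q) :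
    (∃ x : Matrix.symplecticGroup (Fin 2) F,
        (∃ k : ℕ, orderOf x = 2 ^ k) ∧
          ∃! P : Sylow 2 (Matrix.symplecticGroup (Fin 2) F), x ∈ P) ↔
      (q ≠ 5 ∧ q ≠ 7 ∧ (IsFermatPrime q ∨ IsMersennePrime q)) := by
  subst hF
  rw [exists_orderOf_and_existsUnique_sylow_two_iff,
    exists_isTopTwoSubgroup_congr (SpFour.symplecticEquiv F), SpFour.exists_isTop_iff hodd]
end
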